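/- (Second variation of the area under the conformal constraint.) Let Λ = ℤv₁ ⊕ ℤv₂ ⊂ ℝ² be a lattice with fundamental parallelogram P, and let Φ : (−1,1) × ℝ² → ℝ⁴ be smooth with |Φ(t,x)| = 1 for all (t,x), with Φ(t,·) =: Φ_t being Λ-periodic immersions for all t, C² in t. Suppose Φ₀ is a conformal immersion into S³ with conformal factor e^λ, Gauss map n, second fundamental form I_{ij}, mean curvature H, and trace-free coefficients I⁰₁₁, I⁰₁₂. Fix constants Q₁, Q₂ ∈ ℝ and define q̄₁₁ := 2Q₁, q̄₂₂ := −2Q₁, q̄₁₂ = q̄₂₁ := −2Q₂; for each t set (g_t)_{ij} := ∂_{x_i}Φ_t·∂_{x_j}Φ_t with inverse (g_t^{ij}), n_t the positively oriented unit normal, (I_t)_{ij} := n_t·∂²_{x_ix_j}Φ_t, H_t := (1/2)Σ g_t^{ij}(I_t)_{ij}, (I⁰_t)_{ij} := (I_t)_{ij} − H_t (g_t)_{ij}, and ⟨q̄, I⁰_t⟩_{g_t} := Σ_{i,j,k,l} g_t^{ki} g_t^{jl} q̄_{kl} (I⁰_t)_{ij}. Assume: (a) at t = 0, H = 4 e^{−4λ}(Q₁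 I⁰₁₁ − Q₂ I⁰₁₂) pointwise; and (b) for every t ∈ (−1,1): ∫_P ⟨q̄, I⁰_t⟩_{g_t} (n_t · ∂_tΦ_t) √(det g_t) dx = 0. Write ∂_tΦ(0,·) = σ₁∂_{x₁}Φ₀ + σ₂∂_{x₂}Φ₀ + v n and set S := −4 e^{−4λ}(Q₁ I⁰₁₂ + Q₂ I⁰₁₁). Then A(t) := ∫_P √(det g_t) dx satisfies A''(0) = ∫_P e^{2λ} [ e^{−2λ}((∂_{x₁}v)² + (∂_{x₂}v)²) − 4 e^{−4λ}( Q₁((∂_{x₁}v)² − (∂_{x₂}v)²) − 2 Q₂ ∂_{x₁}v ∂_{x₂}v ) − ( e^{−4λ}(I₁₁² + 2I₁₂² + I₂₂²) + 2 − 8H² ) v² ] dx + ∫_P e^{2λ} [ 2H(σ₁∂_{x₁}v + σ₂∂_{x₂}v) + v(σ₁∂_{x₁}H + σ₂∂_{x₂}H) + 4 v e^{−2λ}( Q₁(σ₁∂_{x₁}H − σ₂∂_{x₂}H) − Q₂(σ₁∂_{x₂}H + σ₂∂_{x₁}H) ) + S (σ₂∂_{x₁}v − σ₁∂_{x₂}v)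 ] dx − ∫_P S v ( ∂_{x₁}(e^{2λ}σ₂) − ∂_{x₂}(e^{2λ}σ₁) ) dx. -/

import Mathlib

noncomputable section

open Real MeasureTheory
open scoped ENNReal RealInnerProductSpace

/-- The plane `ℝ²`. -/
abbrev RR2 := ℝ × ℝ
/-- Euclidean `ℝ⁴`. -/
abbrev RR4 := EuclideanSpace ℝ (Fin 4)

/-- Partial derivative in the `x₁` direction of an `ℝ⁴`-valued map on `ℝ²`. -/
def d1 (f : RR2 → RR4) (x : RR2) : RR4 := fderiv ℝ f x (1, 0)
/-- Partial derivative in the `x₂` direction of an `ℝ⁴`-valued map on `ℝ²`. -/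
def d2 (f : RR2 → RR4) (x : RR2) : RR4 := fderiv ℝ f x (0, 1)
/-- Partial derivative in the `x₁` direction of a scalar map on `ℝ²`. -/
def d1s (f : RR2 → ℝ) (x : RR2) : ℝ := fderiv ℝ f x (1, 0)
/-- Partial derivative in the `x₂` direction of a scalar map on `ℝ²`. -/
def d2s (f : RR2 → ℝ) (x : RR2) : ℝ := fderiv ℝ f x (0, 1)

/-- Determinant of four vectors of `ℝ⁴`. -/
def det4 (a b c d : RR4) : ℝ :=
  Matrix.det (Matrix.of ![(fun i => a i), (fun i => b i), (fun i => c i), (fun i => d i)])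

/-- `Φ : U → S³ ⊂ ℝ⁴` is a smooth conformal immersion into `S³` with conformal factor
`e^lam` and (positively oriented) Gauss map `n`. -/
structure IsConformalImmersionS3 (U : Set RR2) (Φ : RR2 → RR4) (lam : RR2 → ℝ)
    (n : RR2 → RR4) : Prop where
  smooth_Phi : ContDiffOn ℝ (⊤ : ℕ∞) Φ U
  smooth_lam : ContDiffOn ℝ (⊤ : ℕ∞) lam U
  smooth_n : ContDiffOn ℝ (⊤ : ℕ∞) n U
  mem_sphere : ∀ x ∈ U, ‖Φ x‖ = 1
  conf_orth : ∀ x ∈ U, ⟪d1 Φ x, d2 Φ x⟫ = 0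
  conf_norm1 : ∀ x ∈ U, ‖d1 Φ x‖ = exp (lam x)
  conf_norm2 : ∀ x ∈ U, ‖d2 Φ x‖ = exp (lam x)
  n_norm : ∀ x ∈ U, ‖n x‖ = 1
  n_orth_Phi : ∀ x ∈ U, ⟪n x, Φ x⟫ = 0
  n_orth_d1 : ∀ x ∈ U, ⟪n x, d1 Φ x⟫ = 0
  n_orth_d2 : ∀ x ∈ U, ⟪n x, d2 Φ x⟫ = 0
  oriented : ∀ x ∈ U, 0 < det4 (Φ x) (d1 Φ x) (d2 Φ x) (n x)

/-- Second fundamental form coefficient `I₁₁ = n·∂²_{x₁x₁}Φ`. -/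
def I11 (Φ n : RR2 → RR4) (x : RR2) : ℝ := ⟪n x, d1 (d1 Φ) x⟫
/-- Second fundamental form coefficient `I₁₂ = n·∂²_{x₁x₂}Φ`. -/
def I12 (Φ n : RR2 → RR4) (x : RR2) : ℝ := ⟪n x, d2 (d1 Φ) x⟫
/-- Second fundamental form coefficient `I₂₂ = n·∂²_{x₂x₂}Φ`. -/
def I22 (Φ n : RR2 → RR4) (x : RR2) : ℝ := ⟪n x, d2 (d2 Φ) x⟫

/-- Mean curvature `H = (1/2) e^{-2λ} (I₁₁ + I₂₂)`. -/
def meanCurv (Φ : RR2 → RR4) (lam : RR2 → ℝ) (n : RR2 → RR4) (x : RR2) : ℝ :=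
  (1 / 2) * exp (-(2 * lam x)) * (I11 Φ n x + I22 Φ n x)

/-- Trace-free Weingarten coefficient `I⁰₁₁ = (I₁₁ - I₂₂)/2`. -/
def I011 (Φ n : RR2 → RR4) (x : RR2) : ℝ := (I11 Φ n x - I22 Φ n x) / 2
/-- Trace-free Weingarten coefficient `I⁰₁₂ = I₁₂`. -/
def I012 (Φ n : RR2 → RR4) (x : RR2) : ℝ := I12 Φ n x

/-- The induced metric matrix `g_{ij} = ∂_{x_i}f · ∂_{x_j}f` of a map `f : ℝ² → ℝ⁴`. -/
def gmat (f : RR2 → RR4) (x : RR2) : Matrix (Fin 2) (Fin 2) ℝ :=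
  !![⟪d1 f x, d1 f x⟫, ⟪d1 f x, d2 f x⟫; ⟪d2 f x, d1 f x⟫, ⟪d2 f x, d2 f x⟫]

/-- The second fundamental form matrix `I_{ij} = nf·∂²_{x_i x_j}f` of a map `f` with
unit normal `nf`. -/
def Imat (f nf : RR2 → RR4) (x : RR2) : Matrix (Fin 2) (Fin 2) ℝ :=
  !![I11 f nf x, I12 f nf x; I12 f nf x, I22 f nf x]

/-- The mean curvature `H = (1/2) Σ g^{ij} I_{ij}` of a (not necessarily conformal)
immersion `f` with unit normal `nf`. -/
def Hgen (f nf : RR2 → RR4) (x : RR2) : ℝ :=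
  (1 / 2) * ∑ i : Fin 2, ∑ j : Fin 2, (gmat f x)⁻¹ i j * Imat f nf x i j

/-- The trace-free second fundamental form `I⁰_{ij} = I_{ij} - H g_{ij}`. -/
def I0mat (f nf : RR2 → RR4) (x : RR2) : Matrix (Fin 2) (Fin 2) ℝ :=
  Imat f nf x - Hgen f nf x • gmat f x

/-- The constant symmetric trace-free tensor `q̄ = 2Q₁(dx₁²-dx₂²) - 2Q₂(dx₁⊗dx₂+dx₂⊗dx₁)`,
twice the real part of the holomorphic quadratic differential `(Q₁+iQ₂)dz²`. -/
def qbar (Q₁ Q₂ : ℝ) : Matrix (Fin 2) (Fin 2) ℝ :=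
  !![2 * Q₁, -(2 * Q₂); -(2 * Q₂), -(2 * Q₁)]

/-- The pairing `⟨q̄, I⁰⟩_g = Σ g^{ki} g^{jl} q̄_{kl} I⁰_{ij}`. -/
def qPairing (Q₁ Q₂ : ℝ) (f nf : RR2 → RR4) (x : RR2) : ℝ :=
  ∑ i : Fin 2, ∑ j : Fin 2, ∑ k : Fin 2, ∑ l : Fin 2,
    (gmat f x)⁻¹ k i * (gmat f x)⁻¹ j l * qbar Q₁ Q₂ k l * I0mat f nf x i j


namespace SV

open Set Filter Topology
open scoped ContDiff

section calculus

variable {V : Type*} [NormedAddCommGroup V] [NormedSpace ℝ V]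
variable {F : Type*} [NormedAddCommGroup F] [NormedSpace ℝ F]

/-- Directional derivative. -/
def DD (e : V) (f : V → F) (x : V) : F := fderiv ℝ f x e

@[fun_prop]
lemma DD_contDiff (e : V) {f : V → F} (hf : ContDiff ℝ ∞ f) : ContDiff ℝ ∞ (DD e f) := by
  unfold DD
  exact (hf.fderiv_right (m := ∞) (by norm_num)).clm_apply contDiff_const

lemma sm_diff {f : V → F} (hf : ContDiff ℝ ∞ f) (x : V) : DifferentiableAt ℝ f x :=
  (hf.differentiable (by norm_num)) x

lemma DD_add (e : V) {f g : V → F} (hf : ContDiff ℝ ∞ f) (hg : ContDiff ℝ ∞ g) (x : V) :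
    DD e (fun y => f y + g y) x = DD e f x + DD e g x := by
  unfold DD; rw [fderiv_fun_add (sm_diff hf x) (sm_diff hg x)]; rfl

lemma DD_sub (e : V) {f g : V → F} (hf : ContDiff ℝ ∞ f) (hg : ContDiff ℝ ∞ g) (x : V) :
    DD e (fun y => f y - g y) x = DD e f x - DD e g x := by
  unfold DD; rw [fderiv_fun_sub (sm_diff hf x) (sm_diff hg x)]; rfl

lemma DD_neg (e : V) {f : V → F} (x : V) :
    DD e (fun y => - f y) x = - DD e f x := by
  unfold DD; rw [fderiv_fun_neg]; rfl

lemma DD_const (e : V) (c : F) (x : V) : DD e (fun _ => c) x = 0 := by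
  unfold DD; simp

lemma DD_smul (e : V) {f : V → ℝ} {g : V → F} (hf : ContDiff ℝ ∞ f) (hg : ContDiff ℝ ∞ g) (x : V) :
    DD e (fun y => f y • g y) x = DD e f x • g x + f x • DD e g x := by
  unfold DD; rw [fderiv_fun_smul (sm_diff hf x) (sm_diff hg x)]
  simp [add_comm]

lemma DD_mul (e : V) {f g : V → ℝ} (hf : ContDiff ℝ ∞ f) (hg : ContDiff ℝ ∞ g) (x : V) :
    DD e (fun y => f y * g y) x = DD e f x * g x + f x * DD e g x := by
  exact DD_smul e hf hg x

lemma DD_cmul (e : V) (c : ℝ) {g : V → ℝ} (hg : ContDiff ℝ ∞ g) (x : V) :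
    DD e (fun y => c * g y) x = c * DD e g x := by
  rw [DD_mul e contDiff_const hg, DD_const]; ring

lemma DD_exp (e : V) {f : V → ℝ} (hf : ContDiff ℝ ∞ f) (x : V) :
    DD e (fun y => Real.exp (f y)) x = Real.exp (f x) * DD e f x := by
  unfold DD; rw [fderiv_exp (sm_diff hf x)]; rfl

lemma DD_inner (e : V) {f g : V → RR4} (hf : ContDiff ℝ ∞ f) (hg : ContDiff ℝ ∞ g) (x : V) :
    DD e (fun y => (⟪f y, g y⟫ : ℝ)) x = ⟪DD e f x, g x⟫ + ⟪f x, DD e g x⟫ := by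
  unfold DD; rw [fderiv_inner_apply ℝ (sm_diff hf x) (sm_diff hg x)]; ring

lemma DD_comm (e e' : V) {f : V → F} (hf : ContDiff ℝ ∞ f) (x : V) :
    DD e (DD e' f) x = DD e' (DD e f) x := by
  have hs : IsSymmSndFDerivAt ℝ f x :=
    (hf.contDiffAt).isSymmSndFDerivAt (by
      rw [minSmoothness_of_isRCLikeNormedField]; exact ENat.LEInfty.out)
  have hd : DifferentiableAt ℝ (fderiv ℝ f) x :=
    ((hf.fderiv_right (m := ∞) (by norm_num)).differentiable (by norm_num)) x
  have h : ∀ a b : V, DD a (DD b f) x = fderiv ℝ (fderiv ℝ f) x a b := by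
    intro a b
    unfold DD
    rw [fderiv_clm_apply hd (differentiableAt_const _)]
    simp
  rw [h, h]; exact hs e e'

end calculus

/-- time slice rules -/
lemma DD_slice {F : Type*} [NormedAddCommGroup F] [NormedSpace ℝ F] {f : ℝ × RR2 → F}
    (hf : ContDiff ℝ ∞ f) (t : ℝ) (e : RR2) :
    DD e (fun y => f (t, y)) = fun y => DD ((0 : ℝ), e) f (t, y) := by
  funext x
  have h : HasFDerivAt (fun y : RR2 => (t, y)) (ContinuousLinearMap.inr ℝ ℝ RR2) x :=
    hasFDerivAt_prodMk_right t x
  have := (sm_diff hf (t, x)).hasFDerivAt.comp x h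
  unfold DD
  rw [show (fun y => f (t, y)) = f ∘ (fun y => (t, y)) from rfl, this.fderiv]
  simp

lemma hasDerivAt_slice {F : Type*} [NormedAddCommGroup F] [NormedSpace ℝ F] {f : ℝ × RR2 → F}
    (hf : ContDiff ℝ ∞ f) (t : ℝ) (x : RR2) :
    HasDerivAt (fun s => f (s, x)) (DD ((1 : ℝ), (0 : RR2)) f (t, x)) t := by
  have h : HasFDerivAt (fun y : ℝ => (y, x)) (ContinuousLinearMap.inl ℝ ℝ RR2) t :=
    hasFDerivAt_prodMk_left t x
  have := (sm_diff hf (t, x)).hasFDerivAt.comp t h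
  have := this.hasDerivAt
  simpa [DD, Function.comp_def] using this

section integral

variable (v₁ v₂ : RR2)

/-- fundamental parallelogram -/
def Par : Set RR2 := (fun p : ℝ × ℝ => p.1 • v₁ + p.2 • v₂) '' (Set.Ico 0 1 ×ˢ Set.Ico 0 1)

def Lmap : RR2 →L[ℝ] RR2 :=
  (ContinuousLinearMap.fst ℝ ℝ ℝ).smulRight v₁ + (ContinuousLinearMap.snd ℝ ℝ ℝ).smulRight v₂

lemma Lmap_apply (p : RR2) : Lmap v₁ v₂ p = p.1 • v₁ + p.2 • v₂ := by simp [Lmap]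

variable {v₁ v₂}

lemma Lmap_inj (h : LinearIndependent ℝ ![v₁, v₂]) : Function.Injective (Lmap v₁ v₂) := by
  rw [injective_iff_map_eq_zero]
  intro p hp
  rw [Lmap_apply] at hp
  have := LinearIndependent.pair_iff.1 h p.1 p.2 hp
  exact Prod.ext this.1 this.2

lemma Par_eq : Par v₁ v₂ = Lmap v₁ v₂ '' (Set.Ico 0 1 ×ˢ Set.Ico 0 1) := by
  unfold Par; congr 1

lemma Par_meas (h : LinearIndependent ℝ ![v₁, v₂]) : MeasurableSet (Par v₁ v₂) := by
  rw [Par_eq]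
  exact (measurableSet_Ico.prod measurableSet_Ico).image_of_continuousOn_injOn
    (Lmap v₁ v₂).continuous.continuousOn (Lmap_inj h).injOn

lemma Par_cpt : ∃ K : Set RR2, IsCompact K ∧ Par v₁ v₂ ⊆ K := by
  refine ⟨Lmap v₁ v₂ '' (Set.Icc 0 1 ×ˢ Set.Icc 0 1),
    (isCompact_Icc.prod isCompact_Icc).image (Lmap v₁ v₂).continuous, ?_⟩
  rw [Par_eq]
  exact Set.image_mono (Set.prod_mono Set.Ico_subset_Icc_self Set.Ico_subset_Icc_self)

lemma Par_integrable {f : RR2 → ℝ} (hf : Continuous f) :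
    IntegrableOn f (Par v₁ v₂) := by
  obtain ⟨K, hK, hs⟩ := Par_cpt (v₁ := v₁) (v₂ := v₂)
  exact (hf.continuousOn.integrableOn_compact hK).mono_set hs

lemma Par_hasDerivAt (h : LinearIndependent ℝ ![v₁, v₂]) {f : ℝ × RR2 → ℝ} (hf : ContDiff ℝ ∞ f)
    (t : ℝ) : HasDerivAt (fun s => ∫ x in Par v₁ v₂, f (s, x))
      (∫ x in Par v₁ v₂, DD ((1 : ℝ), (0 : RR2)) f (t, x)) t := by
  obtain ⟨K, hK, hs⟩ := Par_cpt (v₁ := v₁) (v₂ := v₂)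
  have hc : Continuous (DD ((1 : ℝ), (0 : RR2)) f) := (DD_contDiff _ hf).continuous
  obtain ⟨C, hC⟩ := ((isCompact_Icc (a := t - 1) (b := t + 1)).prod hK).exists_bound_of_continuousOn
    hc.continuousOn
  have hfin : volume (Par v₁ v₂) ≠ ⊤ := ((measure_mono hs).trans_lt hK.measure_lt_top).ne
  refine (hasDerivAt_integral_of_dominated_loc_of_deriv_le (s := Icc (t - 1) (t + 1))
    (bound := fun _ => C) (F := fun s x => f (s, x))
    (F' := fun s x => DD ((1 : ℝ), (0 : RR2)) f (s, x))
    (Icc_mem_nhds (by linarith) (by linarith)) ?_ ?_ ?_ ?_ ?_ ?_).2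
  · refine Eventually.of_forall fun s => ?_
    exact (hf.continuous.comp (by fun_prop : Continuous fun x : RR2 => (s, x))).aestronglyMeasurable
  · exact Par_integrable (hf.continuous.comp (by fun_prop : Continuous fun x : RR2 => (t, x)))
  · exact (hc.comp (by fun_prop : Continuous fun x : RR2 => (t, x))).aestronglyMeasurable
  · refine (ae_restrict_iff' (Par_meas h)).2 (Eventually.of_forall fun x hx s hs' => ?_)
    exact hC (s, x) ⟨hs', hs hx⟩
  · exact integrableOn_const hfin
  · exact Eventually.of_forall fun x s _ => hasDerivAt_slice hf s x

/-- periodicity -/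
def Per (v₁ v₂ : RR2) {β : Type*} (f : RR2 → β) : Prop :=
  ∀ x, f (x + v₁) = f x ∧ f (x + v₂) = f x

lemma Per.DD {F : Type*} [NormedAddCommGroup F] [NormedSpace ℝ F] {f : RR2 → F}
    (hf : Per v₁ v₂ f) (e : RR2) : Per v₁ v₂ (DD e f) := by
  intro x
  unfold SV.DD
  constructor
  · have : (fun y => f (y + v₁)) = f := funext fun y => (hf y).1
    rw [← fderiv_comp_add_right, this]
  · have : (fun y => f (y + v₂)) = f := funext fun y => (hf y).2
    rw [← fderiv_comp_add_right, this]

lemma int_v1 (h : LinearIndependent ℝ ![v₁, v₂]) {f : RR2 → ℝ} (hf : ContDiff ℝ ∞ f)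
    (hp : Per v₁ v₂ f) (e : RR2) :
    ∫ x in Par v₁ v₂, DD e f x = 0 := by
  -- change of variables
  have cov : ∀ u : RR2 → ℝ, ∫ x in Par v₁ v₂, u x
      = |(Lmap v₁ v₂).det| * ∫ p in (Set.Ico (0:ℝ) 1 ×ˢ Set.Ico (0:ℝ) 1), u (Lmap v₁ v₂ p) := by
    intro u
    rw [Par_eq, integral_image_eq_integral_abs_det_fderiv_smul volume
      (measurableSet_Ico.prod measurableSet_Ico)
      (fun x _ => (Lmap v₁ v₂).hasFDerivAt.hasFDerivWithinAt) (Lmap_inj h).injOn,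
      ← integral_const_mul]
    rfl
  have hcont : ∀ w : RR2, Continuous fun p => DD w f (Lmap v₁ v₂ p) := fun w =>
    (DD_contDiff w hf).continuous.comp (Lmap v₁ v₂).continuous
  have hInt : ∀ w : RR2, IntegrableOn (fun p => DD w f (Lmap v₁ v₂ p))
      (Set.Ico (0:ℝ) 1 ×ˢ Set.Ico (0:ℝ) 1) := fun w =>
    ((hcont w).continuousOn.integrableOn_compact
      (isCompact_Icc.prod isCompact_Icc)).mono_set
      (Set.prod_mono Set.Ico_subset_Icc_self Set.Ico_subset_Icc_self)
  have hd : ∀ p w : RR2, HasFDerivAt f (fderiv ℝ f p) p := fun p w => (sm_diff hf p).hasFDerivAt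
  have h2 : ∫ p in (Set.Ico (0:ℝ) 1 ×ˢ Set.Ico (0:ℝ) 1), DD v₂ f (Lmap v₁ v₂ p) = 0 := by
    rw [Measure.volume_eq_prod, setIntegral_prod _ (hInt v₂)]
    have : ∀ s : ℝ, ∫ t in Set.Ico (0:ℝ) 1, DD v₂ f (Lmap v₁ v₂ (s, t)) = 0 := by
      intro s
      rw [integral_Ico_eq_integral_Ioc, ← intervalIntegral.integral_of_le zero_le_one,
        intervalIntegral.integral_eq_sub_of_hasDerivAt
          (f := fun t => f (Lmap v₁ v₂ (s, t)))]
      · simp only [Lmap_apply, one_smul, zero_smul, add_zero]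
        rw [(hp _).2, sub_self]
      · intro t _
        have hL : HasDerivAt (fun t : ℝ => Lmap v₁ v₂ (s, t)) v₂ t := by
          simp only [Lmap_apply]
          simpa using ((hasDerivAt_id t).smul_const v₂).const_add (s • v₁)
        exact (sm_diff hf _).hasFDerivAt.comp_hasDerivAt t hL
      · exact ((hcont v₂).comp (by fun_prop : Continuous fun t : ℝ => (s, t))).intervalIntegrable _ _
    simp [this]
  have h1 : ∫ p in (Set.Ico (0:ℝ) 1 ×ˢ Set.Ico (0:ℝ) 1), DD v₁ f (Lmap v₁ v₂ p) = 0 := by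
    rw [Measure.volume_eq_prod, ← setIntegral_prod_swap, setIntegral_prod]
    swap
    · exact (hInt v₁).swap
    have : ∀ s : ℝ, ∫ t in Set.Ico (0:ℝ) 1, DD v₁ f (Lmap v₁ v₂ (t, s)) = 0 := by
      intro s
      rw [integral_Ico_eq_integral_Ioc, ← intervalIntegral.integral_of_le zero_le_one,
        intervalIntegral.integral_eq_sub_of_hasDerivAt
          (f := fun t => f (Lmap v₁ v₂ (t, s)))]
      · simp only [Lmap_apply, one_smul, zero_smul, zero_add]
        rw [add_comm v₁, (hp _).1, sub_self]
      · intro t _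
        have hL : HasDerivAt (fun t : ℝ => Lmap v₁ v₂ (t, s)) v₁ t := by
          simp only [Lmap_apply]
          simpa using ((hasDerivAt_id t).smul_const v₁).add_const (s • v₂)
        exact (sm_diff hf _).hasFDerivAt.comp_hasDerivAt t hL
      · exact ((hcont v₁).comp (by fun_prop : Continuous fun t : ℝ => (t, s))).intervalIntegrable _ _
    simp [this]
  obtain ⟨a, ha⟩ : ∃ a, Lmap v₁ v₂ a = e :=
    (LinearMap.injective_iff_surjective (f := (Lmap v₁ v₂ : RR2 →ₗ[ℝ] RR2))).1 (Lmap_inj h) e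
  have he : ∀ p, DD e f p = a.1 * DD v₁ f p + a.2 * DD v₂ f p := by
    intro p; rw [← ha, Lmap_apply]; simp [DD]
  rw [cov]
  simp only [he]
  rw [integral_add ((hInt v₁).const_mul _) ((hInt v₂).const_mul _), integral_const_mul,
    integral_const_mul, h1, h2]
  simp

end integral

end SV

namespace SV

open Set Filter Topology
open scoped ContDiff
set_option linter.unusedSimpArgs false

lemma inner4 (a b : RR4) : (⟪a, b⟫ : ℝ) = a 0 * b 0 + a 1 * b 1 + a 2 * b 2 + a 3 * b 3 := by
  simp [PiLp.inner_apply, Fin.sum_univ_four, mul_comm]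

lemma eq_zero_of_det4 {a b c d z : RR4} (h : 0 < det4 a b c d) (ha : (⟪a, z⟫ : ℝ) = 0)
    (hb : (⟪b, z⟫ : ℝ) = 0) (hc : (⟪c, z⟫ : ℝ) = 0) (hd : (⟪d, z⟫ : ℝ) = 0) : z = 0 := by
  have := Matrix.eq_zero_of_mulVec_eq_zero (v := fun i => z i) h.ne' (by
    funext i
    rw [inner4] at ha hb hc hd
    fin_cases i
    · simpa [Matrix.mulVec, dotProduct, Fin.sum_univ_four] using ha
    · simpa [Matrix.mulVec, dotProduct, Fin.sum_univ_four] using hb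
    · simpa [Matrix.mulVec, dotProduct, Fin.sum_univ_four] using hc
    · simpa [Matrix.mulVec, dotProduct, Fin.sum_univ_four] using hd)
  ext i
  exact congrFun this i

lemma det4_eq (a b c d : RR4) : det4 a b c d =
    a 0 * (b 1 * (c 2 * d 3 - c 3 * d 2) - b 2 * (c 1 * d 3 - c 3 * d 1)
      + b 3 * (c 1 * d 2 - c 2 * d 1))
    - a 1 * (b 0 * (c 2 * d 3 - c 3 * d 2) - b 2 * (c 0 * d 3 - c 3 * d 0)
      + b 3 * (c 0 * d 2 - c 2 * d 0))
    + a 2 * (b 0 * (c 1 * d 3 - c 3 * d 1) - b 1 * (c 0 * d 3 - c 3 * d 0)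
      + b 3 * (c 0 * d 1 - c 1 * d 0))
    - a 3 * (b 0 * (c 1 * d 2 - c 2 * d 1) - b 1 * (c 0 * d 2 - c 2 * d 0)
      + b 2 * (c 0 * d 1 - c 1 * d 0)) := by
  simp [det4, Matrix.det_succ_row_zero, Fin.sum_univ_succ, Fin.succAbove]
  ring

/-- the generalized cross product in `ℝ⁴` -/
def crossN (a b c : RR4) : RR4 :=
  !₂[-(a 1 * (b 2 * c 3 - b 3 * c 2) - a 2 * (b 1 * c 3 - b 3 * c 1)
      + a 3 * (b 1 * c 2 - b 2 * c 1)),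
    a 0 * (b 2 * c 3 - b 3 * c 2) - a 2 * (b 0 * c 3 - b 3 * c 0)
      + a 3 * (b 0 * c 2 - b 2 * c 0),
    -(a 0 * (b 1 * c 3 - b 3 * c 1) - a 1 * (b 0 * c 3 - b 3 * c 0)
      + a 3 * (b 0 * c 1 - b 1 * c 0)),
    a 0 * (b 1 * c 2 - b 2 * c 1) - a 1 * (b 0 * c 2 - b 2 * c 0)
      + a 2 * (b 0 * c 1 - b 1 * c 0)]

lemma inner_crossN (a b c d : RR4) : (⟪crossN a b c, d⟫ : ℝ) = det4 a b c d := by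
  rw [inner4, det4_eq]; simp [crossN]; ring

lemma normal_eq {a b c N : RR4} (hN : ‖N‖ = 1) (ha : (⟪N, a⟫ : ℝ) = 0) (hb : (⟪N, b⟫ : ℝ) = 0)
    (hc : (⟪N, c⟫ : ℝ) = 0) (hd : 0 < det4 a b c N) :
    crossN a b c ≠ 0 ∧ N = ‖crossN a b c‖⁻¹ • crossN a b c := by
  set C := crossN a b c with hC
  have hNN : (⟪N, N⟫ : ℝ) = 1 := by rw [real_inner_self_eq_norm_sq, hN]; norm_num
  have hCN : (⟪C, N⟫ : ℝ) = det4 a b c N := inner_crossN _ _ _ _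
  have h0 : C - (⟪C, N⟫ : ℝ) • N = 0 := by
    apply eq_zero_of_det4 hd
    · rw [inner_sub_right, inner_smul_right, real_inner_comm, inner_crossN, real_inner_comm N a, ha,
        det4_eq]; ring
    · rw [inner_sub_right, inner_smul_right, real_inner_comm, inner_crossN, real_inner_comm N b, hb,
        det4_eq]; ring
    · rw [inner_sub_right, inner_smul_right, real_inner_comm, inner_crossN, real_inner_comm N c, hc,
        det4_eq]; ring
    · rw [inner_sub_right, inner_smul_right, hNN, real_inner_comm]; ring
  have h1 : C = det4 a b c N • N := by rw [← hCN]; exact sub_eq_zero.1 h0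
  have h2 : ‖C‖ = det4 a b c N := by
    rw [h1, norm_smul, hN, Real.norm_of_nonneg hd.le, mul_one]
  constructor
  · intro h; rw [h, norm_zero] at h2; exact hd.ne h2
  · rw [h2, h1, smul_smul, inv_mul_cancel₀ hd.ne', one_smul]

lemma crossN_smooth {V : Type*} [NormedAddCommGroup V] [NormedSpace ℝ V] {a b c : V → RR4}
    (ha : ContDiff ℝ ∞ a) (hb : ContDiff ℝ ∞ b) (hc : ContDiff ℝ ∞ c) :
    ContDiff ℝ ∞ (fun x => crossN (a x) (b x) (c x)) := by
  have ha' := contDiff_euclidean.1 ha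
  have hb' := contDiff_euclidean.1 hb
  have hc' := contDiff_euclidean.1 hc
  rw [contDiff_euclidean]
  intro i
  have := ha' 0; have := ha' 1; have := ha' 2; have := ha' 3
  have := hb' 0; have := hb' 1; have := hb' 2; have := hb' 3
  have := hc' 0; have := hc' 1; have := hc' 2; have := hc' 3
  fin_cases i <;> simp [crossN] <;> fun_prop

lemma normal_smooth {V : Type*} [NormedAddCommGroup V] [NormedSpace ℝ V] {a b c N : V → RR4}
    (ha : ContDiff ℝ ∞ a) (hb : ContDiff ℝ ∞ b) (hc : ContDiff ℝ ∞ c)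
    (hN : ∀ x, ‖N x‖ = 1) (hNa : ∀ x, (⟪N x, a x⟫ : ℝ) = 0) (hNb : ∀ x, (⟪N x, b x⟫ : ℝ) = 0)
    (hNc : ∀ x, (⟪N x, c x⟫ : ℝ) = 0) (hd : ∀ x, 0 < det4 (a x) (b x) (c x) (N x)) :
    ContDiff ℝ ∞ N := by
  have h := fun x => normal_eq (hN x) (hNa x) (hNb x) (hNc x) (hd x)
  rw [show N = fun x => ‖crossN (a x) (b x) (c x)‖⁻¹ • crossN (a x) (b x) (c x) from
    funext fun x => (h x).2]
  have hs := crossN_smooth ha hb hc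
  exact ((hs.norm ℝ fun x => (h x).1).inv fun x => norm_ne_zero_iff.2 (h x).1).smul hs

/-- expansion of an inner product in a conformal orthogonal frame -/
lemma parseval {f f1 f2 n a b : RR4} {E : ℝ} (hE : E ≠ 0) (hdet : 0 < det4 f f1 f2 n)
    (hff : (⟪f, f⟫ : ℝ) = 1) (h11 : (⟪f1, f1⟫ : ℝ) = E) (h22 : (⟪f2, f2⟫ : ℝ) = E)
    (h12 : (⟪f1, f2⟫ : ℝ) = 0) (hf1 : (⟪f, f1⟫ : ℝ) = 0) (hf2 : (⟪f, f2⟫ : ℝ) = 0)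
    (hnn : (⟪n, n⟫ : ℝ) = 1) (hnf : (⟪n, f⟫ : ℝ) = 0) (hn1 : (⟪n, f1⟫ : ℝ) = 0)
    (hn2 : (⟪n, f2⟫ : ℝ) = 0) :
    (⟪a, b⟫ : ℝ) = ⟪a, f⟫ * ⟪b, f⟫ + E⁻¹ * (⟪a, f1⟫ * ⟪b, f1⟫ + ⟪a, f2⟫ * ⟪b, f2⟫)
      + ⟪a, n⟫ * ⟪b, n⟫ := by
  have h0 : a - ((⟪a, f⟫ : ℝ) • f + (E⁻¹ * ⟪a, f1⟫ : ℝ) • f1 + (E⁻¹ * ⟪a, f2⟫ : ℝ) • f2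
      + (⟪a, n⟫ : ℝ) • n) = 0 := by
    apply eq_zero_of_det4 hdet <;>
    simp only [inner_sub_right, inner_add_right, inner_smul_right, hff, h11, h22, h12, hf1, hf2,
      hnn, hnf, hn1, hn2, real_inner_comm f1 f, real_inner_comm f2 f, real_inner_comm f1 f2,
      real_inner_comm f n, real_inner_comm f1 n, real_inner_comm f2 n, real_inner_comm f f1,
      real_inner_comm f f2, real_inner_comm f2 f1, real_inner_comm n f1, real_inner_comm n f2,
      real_inner_comm n f]
    · rw [real_inner_comm]; ring
    · rw [real_inner_comm]; field_simp; ring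
    · rw [real_inner_comm]; field_simp; ring
    · rw [real_inner_comm]; ring
  rw [sub_eq_zero] at h0
  have := congrArg (fun z => (⟪b, z⟫ : ℝ)) h0
  simp only [inner_add_right, inner_smul_right] at this
  rw [real_inner_comm, this]; ring

/-- a vector orthogonal to `f, n`-complement ... used for the first variation. -/
lemma tangent_orth {f f1 f2 n w V : RR4} (hdet : 0 < det4 f f1 f2 n)
    {g11 g12 g22 : ℝ} (hG : g11 * g22 - g12 ^ 2 ≠ 0)
    (h11 : (⟪f1, f1⟫ : ℝ) = g11) (h22 : (⟪f2, f2⟫ : ℝ) = g22)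
    (h12 : (⟪f1, f2⟫ : ℝ) = g12) (hf1 : (⟪f1, f⟫ : ℝ) = 0) (hf2 : (⟪f2, f⟫ : ℝ) = 0)
    (hnn : (⟪n, n⟫ : ℝ) = 1) (hnf : (⟪n, f⟫ : ℝ) = 0) (hn1 : (⟪n, f1⟫ : ℝ) = 0)
    (hn2 : (⟪n, f2⟫ : ℝ) = 0) (hwf : (⟪w, f⟫ : ℝ) = 0)
    (hV1 : (⟪V, f1⟫ : ℝ) = 0) (hV2 : (⟪V, f2⟫ : ℝ) = 0) :
    (⟪V, w⟫ : ℝ) = ⟪n, w⟫ * ⟪n, V⟫ := by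
  set G := g11 * g22 - g12 ^ 2
  set w1 : ℝ := ⟪w, f1⟫ with hw1
  set w2 : ℝ := ⟪w, f2⟫ with hw2
  have e1 : (⟪f1, w⟫ : ℝ) = w1 := real_inner_comm _ _
  have e2 : (⟪f2, w⟫ : ℝ) = w2 := real_inner_comm _ _
  have h21 : (⟪f2, f1⟫ : ℝ) = g12 := by rw [real_inner_comm]; exact h12
  have h1f : (⟪f, f1⟫ : ℝ) = 0 := by rw [real_inner_comm]; exact hf1
  have h2f : (⟪f, f2⟫ : ℝ) = 0 := by rw [real_inner_comm]; exact hf2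
  have hfn : (⟪f, n⟫ : ℝ) = 0 := by rw [real_inner_comm]; exact hnf
  have h1n : (⟪f1, n⟫ : ℝ) = 0 := by rw [real_inner_comm]; exact hn1
  have h2n : (⟪f2, n⟫ : ℝ) = 0 := by rw [real_inner_comm]; exact hn2
  have hfw : (⟪f, w⟫ : ℝ) = 0 := by rw [real_inner_comm]; exact hwf
  have h0 : G • w - ((g22 * w1 - g12 * w2) • f1 + (g11 * w2 - g12 * w1) • f2
      + (G * ⟪n, w⟫ : ℝ) • n) = 0 := by
    apply eq_zero_of_det4 hdet <;>
    simp only [inner_sub_right, inner_add_right, inner_smul_right, h11, h22, h12, h21, hf1, hf2,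
      h1f, h2f, hfn, h1n, h2n, hnn, hnf, hn1, hn2, hfw, e1, e2, G] <;> ring
  rw [sub_eq_zero] at h0
  have := congrArg (fun z => (⟪V, z⟫ : ℝ)) h0
  simp only [inner_add_right, inner_smul_right, hV1, hV2] at this
  rw [real_inner_comm n V] at this
  apply mul_left_cancel₀ hG
  linear_combination this

end SV

namespace SV

open Set Filter Topology
open scoped ContDiff

lemma gram_pos {f f1 f2 n : RR4} (hdet : 0 < det4 f f1 f2 n)
    (hff : (⟪f, f⟫ : ℝ) = 1) (hf1 : (⟪f, f1⟫ : ℝ) = 0) (hf2 : (⟪f, f2⟫ : ℝ) = 0)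
    (hnn : (⟪n, n⟫ : ℝ) = 1) (hnf : (⟪n, f⟫ : ℝ) = 0) (hn1 : (⟪n, f1⟫ : ℝ) = 0)
    (hn2 : (⟪n, f2⟫ : ℝ) = 0) :
    0 < (⟪f1, f1⟫ : ℝ) * ⟪f2, f2⟫ - ⟪f1, f2⟫ ^ 2 := by
  have key : (⟪f1, f1⟫ : ℝ) * ⟪f2, f2⟫ - ⟪f1, f2⟫ ^ 2 = det4 f f1 f2 n ^ 2 := by
    have h : ∀ a b c d : RR4, det4 a b c d ^ 2 = Matrix.det !![(⟪a, a⟫ : ℝ), ⟪a, b⟫, ⟪a, c⟫, ⟪a, d⟫;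
        ⟪b, a⟫, ⟪b, b⟫, ⟪b, c⟫, ⟪b, d⟫; ⟪c, a⟫, ⟪c, b⟫, ⟪c, c⟫, ⟪c, d⟫;
        ⟪d, a⟫, ⟪d, b⟫, ⟪d, c⟫, ⟪d, d⟫] := by
      intro a b c d
      set M : Matrix (Fin 4) (Fin 4) ℝ :=
        Matrix.of ![(fun i => a i), (fun i => b i), (fun i => c i), (fun i => d i)] with hM
      have h0 : det4 a b c d ^ 2 = (M * M.transpose).det := by
        rw [Matrix.det_mul, Matrix.det_transpose, sq]; rfl
      rw [h0]
      congr 1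
      simp only [inner4]
      ext i j
      fin_cases i <;> fin_cases j <;>
        simp [hM, Matrix.mul_apply, Fin.sum_univ_four]
    rw [h]
    have hfn : (⟪f, n⟫ : ℝ) = 0 := by rw [real_inner_comm]; exact hnf
    have h1n : (⟪f1, n⟫ : ℝ) = 0 := by rw [real_inner_comm]; exact hn1
    have h2n : (⟪f2, n⟫ : ℝ) = 0 := by rw [real_inner_comm]; exact hn2
    have h1f : (⟪f1, f⟫ : ℝ) = 0 := by rw [real_inner_comm]; exact hf1
    have h2f : (⟪f2, f⟫ : ℝ) = 0 := by rw [real_inner_comm]; exact hf2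
    rw [hff, hf1, hf2, hnn, hnf, hn1, hn2, hfn, h1n, h2n, h1f, h2f, real_inner_comm f1 f2]
    simp [Matrix.det_succ_row_zero, Fin.sum_univ_succ, Fin.succAbove]
    ring
  rw [key]; positivity

section fv

variable {V : Type*} [NormedAddCommGroup V] [NormedSpace ℝ V]

/-- metric coefficient -/
def gm (a b : V) (f : V → RR4) (x : V) : ℝ := ⟪DD a f x, DD b f x⟫
/-- second fundamental form coefficient -/
def Lm (a b : V) (f N : V → RR4) (x : V) : ℝ := ⟪N x, DD b (DD a f) x⟫
/-- Gram determinant -/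
def GG (e1 e2 : V) (f : V → RR4) (x : V) : ℝ := gm e1 e1 f x * gm e2 e2 f x - gm e1 e2 f x ^ 2
/-- area density -/
def FF (e1 e2 : V) (f : V → RR4) (x : V) : ℝ := Real.sqrt (GG e1 e2 f x)
/-- mean curvature -/
def HH (e1 e2 : V) (f N : V → RR4) (x : V) : ℝ :=
  (gm e2 e2 f x * Lm e1 e1 f N x - 2 * gm e1 e2 f x * Lm e1 e2 f N x
    + gm e1 e1 f x * Lm e2 e2 f N x) / (2 * GG e1 e2 f x)
/-- flux numerator -/
def PP1 (e0 e1 e2 : V) (f : V → RR4) (x : V) : ℝ :=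
  gm e2 e2 f x * gm e1 e0 f x - gm e1 e2 f x * gm e2 e0 f x
/-- flux numerator -/
def PP2 (e0 e1 e2 : V) (f : V → RR4) (x : V) : ℝ :=
  gm e1 e1 f x * gm e2 e0 f x - gm e1 e2 f x * gm e1 e0 f x
/-- flux -/
def XX1 (e0 e1 e2 : V) (f : V → RR4) (x : V) : ℝ := PP1 e0 e1 e2 f x / FF e1 e2 f x
/-- flux -/
def XX2 (e0 e1 e2 : V) (f : V → RR4) (x : V) : ℝ := PP2 e0 e1 e2 f x / FF e1 e2 f x

variable {f N : V → RR4}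

@[fun_prop]
lemma gm_smooth (a b : V) (hf : ContDiff ℝ ∞ f) : ContDiff ℝ ∞ (gm a b f) := by
  unfold gm; exact ContDiff.inner ℝ (by fun_prop) (by fun_prop)

@[fun_prop]
lemma Lm_smooth (a b : V) (hf : ContDiff ℝ ∞ f) (hN : ContDiff ℝ ∞ N) :
    ContDiff ℝ ∞ (Lm a b f N) := by
  unfold Lm; exact ContDiff.inner ℝ (by fun_prop) (by fun_prop)

@[fun_prop]
lemma GG_smooth (a b : V) (hf : ContDiff ℝ ∞ f) : ContDiff ℝ ∞ (GG a b f) := by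
  unfold GG; fun_prop

@[fun_prop]
lemma PP1_smooth (e a b : V) (hf : ContDiff ℝ ∞ f) : ContDiff ℝ ∞ (PP1 e a b f) := by
  unfold PP1; fun_prop

@[fun_prop]
lemma PP2_smooth (e a b : V) (hf : ContDiff ℝ ∞ f) : ContDiff ℝ ∞ (PP2 e a b f) := by
  unfold PP2; fun_prop

lemma FF_smooth {e1 e2 : V} (hf : ContDiff ℝ ∞ f) (hG : ∀ x, 0 < GG e1 e2 f x) :
    ContDiff ℝ ∞ (FF e1 e2 f) := by
  unfold FF
  exact (GG_smooth e1 e2 hf).sqrt fun x => (hG x).ne'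

lemma FF_pos {e1 e2 : V} (hG : ∀ x, 0 < GG e1 e2 f x) (x : V) : 0 < FF e1 e2 f x :=
  Real.sqrt_pos.2 (hG x)

lemma HH_smooth {e1 e2 : V} (hf : ContDiff ℝ ∞ f) (hN : ContDiff ℝ ∞ N)
    (hG : ∀ x, 0 < GG e1 e2 f x) : ContDiff ℝ ∞ (HH e1 e2 f N) := by
  unfold HH
  refine ContDiff.div (by fun_prop) (by fun_prop) fun x => ?_
  have := hG x; positivity

lemma XX1_smooth {e0 e1 e2 : V} (hf : ContDiff ℝ ∞ f) (hG : ∀ x, 0 < GG e1 e2 f x) :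
    ContDiff ℝ ∞ (XX1 e0 e1 e2 f) := by
  unfold XX1
  exact ContDiff.div (by fun_prop) (FF_smooth hf hG) fun x => (FF_pos hG x).ne'

lemma XX2_smooth {e0 e1 e2 : V} (hf : ContDiff ℝ ∞ f) (hG : ∀ x, 0 < GG e1 e2 f x) :
    ContDiff ℝ ∞ (XX2 e0 e1 e2 f) := by
  unfold XX2
  exact ContDiff.div (by fun_prop) (FF_smooth hf hG) fun x => (FF_pos hG x).ne'

lemma gm_comm (a b : V) (x : V) : gm a b f x = gm b a f x := real_inner_comm _ _

lemma DD_gm (e a b : V) (hf : ContDiff ℝ ∞ f) (x : V) :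
    DD e (gm a b f) x = ⟪DD e (DD a f) x, DD b f x⟫ + ⟪DD a f x, DD e (DD b f) x⟫ := by
  exact DD_inner e (by fun_prop) (by fun_prop) x

lemma DD_GG (e a b : V) (hf : ContDiff ℝ ∞ f) (x : V) :
    DD e (GG a b f) x = DD e (gm a a f) x * gm b b f x + gm a a f x * DD e (gm b b f) x
      - 2 * gm a b f x * DD e (gm a b f) x := by
  have : GG a b f = fun x => gm a a f x * gm b b f x - gm a b f x * gm a b f x := by
    funext x; unfold GG; ring
  rw [this, DD_sub e (by fun_prop) (by fun_prop), DD_mul e (by fun_prop) (by fun_prop),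
    DD_mul e (by fun_prop) (by fun_prop)]
  ring

lemma DD_FF (e : V) {e1 e2 : V} (hf : ContDiff ℝ ∞ f) (hG : ∀ x, 0 < GG e1 e2 f x) (x : V) :
    2 * FF e1 e2 f x * DD e (FF e1 e2 f) x = DD e (GG e1 e2 f) x := by
  have : GG e1 e2 f = fun x => FF e1 e2 f x * FF e1 e2 f x := by
    funext x; unfold FF; rw [Real.mul_self_sqrt (hG x).le]
  rw [this, DD_mul e (FF_smooth hf hG) (FF_smooth hf hG)]; ring

lemma DD_XX1 (e : V) {e0 e1 e2 : V} (hf : ContDiff ℝ ∞ f) (hG : ∀ x, 0 < GG e1 e2 f x) (x : V) :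
    DD e (FF e1 e2 f) x * XX1 e0 e1 e2 f x + FF e1 e2 f x * DD e (XX1 e0 e1 e2 f) x
      = DD e (PP1 e0 e1 e2 f) x := by
  have : PP1 e0 e1 e2 f = fun x => FF e1 e2 f x * XX1 e0 e1 e2 f x := by
    funext x; unfold XX1; rw [mul_div_cancel₀]; exact (FF_pos hG x).ne'
  rw [this, DD_mul e (FF_smooth hf hG) (XX1_smooth hf hG)]

lemma DD_XX2 (e : V) {e0 e1 e2 : V} (hf : ContDiff ℝ ∞ f) (hG : ∀ x, 0 < GG e1 e2 f x) (x : V) :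
    DD e (FF e1 e2 f) x * XX2 e0 e1 e2 f x + FF e1 e2 f x * DD e (XX2 e0 e1 e2 f) x
      = DD e (PP2 e0 e1 e2 f) x := by
  have : PP2 e0 e1 e2 f = fun x => FF e1 e2 f x * XX2 e0 e1 e2 f x := by
    funext x; unfold XX2; rw [mul_div_cancel₀]; exact (FF_pos hG x).ne'
  rw [this, DD_mul e (FF_smooth hf hG) (XX2_smooth hf hG)]

set_option linter.unusedSimpArgs false in
/-- **first variation of the area density** -/
lemma first_variation {e0 e1 e2 : V} (hf : ContDiff ℝ ∞ f)
    (hG : ∀ x, 0 < GG e1 e2 f x) (hs : ∀ x, (⟪f x, f x⟫ : ℝ) = 1)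
    (hNN : ∀ x, (⟪N x, N x⟫ : ℝ) = 1) (hNf : ∀ x, (⟪N x, f x⟫ : ℝ) = 0)
    (hN1 : ∀ x, (⟪N x, DD e1 f x⟫ : ℝ) = 0) (hN2 : ∀ x, (⟪N x, DD e2 f x⟫ : ℝ) = 0)
    (hdet : ∀ x, 0 < det4 (f x) (DD e1 f x) (DD e2 f x) (N x)) (x : V) :
    DD e0 (FF e1 e2 f) x = DD e1 (XX1 e0 e1 e2 f) x + DD e2 (XX2 e0 e1 e2 f) x
      - 2 * HH e1 e2 f N x * ⟪N x, DD e0 f x⟫ * FF e1 e2 f x := by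
  have hsd : ∀ e : V, (⟪DD e f x, f x⟫ : ℝ) = 0 := by
    intro e
    have h1 := DD_inner e hf hf x
    have h2 : (fun y => (⟪f y, f y⟫ : ℝ)) = fun _ => 1 := funext hs
    rw [h2, DD_const, real_inner_comm (DD e f x) (f x)] at h1
    linarith
  have hF := FF_pos hG x
  have hFF : FF e1 e2 f x ^ 2 = GG e1 e2 f x := by
    unfold FF; exact Real.sq_sqrt (hG x).le
  have hGx := (hG x).ne'
  -- abbreviations
  set F := FF e1 e2 f x
  set G := GG e1 e2 f x with hGdef
  have q0 := DD_FF e0 hf hG x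
  have q1 := DD_FF e1 hf hG x
  have q2 := DD_FF e2 hf hG x
  have x1 := DD_XX1 (e0 := e0) e1 hf hG x
  have x2 := DD_XX2 (e0 := e0) e2 hf hG x
  have X1 : F * XX1 e0 e1 e2 f x = PP1 e0 e1 e2 f x := by
    unfold XX1; rw [mul_div_cancel₀]; exact hF.ne'
  have X2 : F * XX2 e0 e1 e2 f x = PP2 e0 e1 e2 f x := by
    unfold XX2; rw [mul_div_cancel₀]; exact hF.ne'
  have hH : 2 * G * HH e1 e2 f N x = gm e2 e2 f x * Lm e1 e1 f N x
      - 2 * gm e1 e2 f x * Lm e1 e2 f N x + gm e1 e1 f x * Lm e2 e2 f N x := by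
    unfold HH; rw [mul_div_cancel₀]; positivity
  -- the vector
  set D1 := DD e1 (GG e1 e2 f) x with hD1
  set D2 := DD e2 (GG e1 e2 f) x with hD2
  set W := DD e0 f x with hW
  set f1 := DD e1 f x with hf1
  set f2 := DD e2 f x with hf2
  set f11 := DD e1 (DD e1 f) x with hf11
  set f12 := DD e1 (DD e2 f) x with hf12
  set f22 := DD e2 (DD e2 f) x with hf22
  have hf21 : DD e2 (DD e1 f) x = f12 := DD_comm e2 e1 hf x
  set g11 := gm e1 e1 f x with hg11
  set g12 := gm e1 e2 f x with hg12
  set g22 := gm e2 e2 f x with hg22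
  have hg11' : (⟪f1, f1⟫ : ℝ) = g11 := rfl
  have hg12' : (⟪f1, f2⟫ : ℝ) = g12 := rfl
  have hg22' : (⟪f2, f2⟫ : ℝ) = g22 := rfl
  have hg21' : (⟪f2, f1⟫ : ℝ) = g12 := by rw [real_inner_comm]; exact hg12'
  set a111 : ℝ := ⟪f11, f1⟫ with ha111
  set a112 : ℝ := ⟪f11, f2⟫ with ha112
  set a121 : ℝ := ⟪f12, f1⟫ with ha121
  set a122 : ℝ := ⟪f12, f2⟫ with ha122
  set a221 : ℝ := ⟪f22, f1⟫ with ha221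
  set a222 : ℝ := ⟪f22, f2⟫ with ha222
  have c1 : ∀ u : RR4, (⟪f1, u⟫ : ℝ) = ⟪u, f1⟫ := fun u => real_inner_comm _ _
  have c2 : ∀ u : RR4, (⟪f2, u⟫ : ℝ) = ⟪u, f2⟫ := fun u => real_inner_comm _ _
  have d1g11 : DD e1 (gm e1 e1 f) x = 2 * a111 := by
    have h : DD e1 (gm e1 e1 f) x = a111 + ⟪f1, f11⟫ := DD_gm _ _ _ hf x
    rw [h, c1]; ring
  have d2g11 : DD e2 (gm e1 e1 f) x = 2 * a121 := by
    have h := DD_gm e2 e1 e1 hf x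
    rw [hf21] at h
    rw [h, c1]; ring
  have d1g22 : DD e1 (gm e2 e2 f) x = 2 * a122 := by
    have h : DD e1 (gm e2 e2 f) x = a122 + ⟪f2, f12⟫ := DD_gm _ _ _ hf x
    rw [h, c2]; ring
  have d2g22 : DD e2 (gm e2 e2 f) x = 2 * a222 := by
    have h : DD e2 (gm e2 e2 f) x = a222 + ⟪f2, f22⟫ := DD_gm _ _ _ hf x
    rw [h, c2]; ring
  have d1g12 : DD e1 (gm e1 e2 f) x = a112 + a121 := by
    have h : DD e1 (gm e1 e2 f) x = a112 + ⟪f1, f12⟫ := DD_gm _ _ _ hf x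
    rw [h, c1]
  have d2g12 : DD e2 (gm e1 e2 f) x = a122 + a221 := by
    have h := DD_gm e2 e1 e2 hf x
    rw [hf21] at h
    rw [h, c1]
  have hD1' : D1 = 2 * a111 * g22 + g11 * (2 * a122) - 2 * g12 * (a112 + a121) := by
    rw [hD1, DD_GG _ _ _ hf, d1g11, d1g22, d1g12]
  have hD2' : D2 = 2 * a121 * g22 + g11 * (2 * a222) - 2 * g12 * (a122 + a221) := by
    rw [hD2, DD_GG _ _ _ hf, d2g11, d2g22, d2g12]
  have hGval : G = g11 * g22 - g12 ^ 2 := rfl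
  set U : RR4 := (2 * G) • ((2 * a122 - (a122 + a221)) • f1 + g22 • f11 - (2 * g12) • f12
      + (2 * a121 - (a112 + a121)) • f2 + g11 • f22)
    - D1 • (g22 • f1 - g12 • f2) - D2 • (g11 • f2 - g12 • f1) with hU
  have hU1 : (⟪U, f1⟫ : ℝ) = 0 := by
    simp only [hU, inner_sub_left, inner_add_left, real_inner_smul_left, hg11', hg12', hg22', hg21',
      ← ha111, ← ha121, ← ha221]
    rw [hD1', hD2', hGval]; ring
  have hU2 : (⟪U, f2⟫ : ℝ) = 0 := by
    simp only [hU, inner_sub_left, inner_add_left, real_inner_smul_left, hg11', hg12', hg22', hg21',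
      ← ha112, ← ha122, ← ha222]
    rw [hD1', hD2', hGval]; ring
  have hUW := tangent_orth (V := U) (w := W) (hdet x) hGx rfl rfl rfl (hsd e1) (hsd e2) (hNN x)
    (hNf x) (hN1 x) (hN2 x) (hsd e0) hU1 hU2
  have hN1' : (⟪N x, f1⟫ : ℝ) = 0 := hN1 x
  have hN2' : (⟪N x, f2⟫ : ℝ) = 0 := hN2 x
  have L11 : (⟪N x, f11⟫ : ℝ) = Lm e1 e1 f N x := rfl
  have L12 : (⟪N x, f12⟫ : ℝ) = Lm e1 e2 f N x := by unfold Lm; rw [hf21]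
  have L22 : (⟪N x, f22⟫ : ℝ) = Lm e2 e2 f N x := rfl
  simp only [hU, inner_sub_left, inner_add_left, real_inner_smul_left, inner_sub_right,
    inner_add_right, real_inner_smul_right, hN1', hN2', L11, L12, L22] at hUW
  -- derivative of PP
  have h10 : DD e1 (gm e1 e0 f) x = ⟪f11, W⟫ + ⟪f1, DD e1 (DD e0 f) x⟫ := DD_gm _ _ _ hf x
  have h20 : DD e1 (gm e2 e0 f) x = ⟪f12, W⟫ + ⟪f2, DD e1 (DD e0 f) x⟫ := DD_gm _ _ _ hf x
  have k10 : DD e2 (gm e1 e0 f) x = ⟪f12, W⟫ + ⟪f1, DD e2 (DD e0 f) x⟫ := by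
    rw [DD_gm _ _ _ hf, hf21]
  have k20 : DD e2 (gm e2 e0 f) x = ⟪f22, W⟫ + ⟪f2, DD e2 (DD e0 f) x⟫ := DD_gm _ _ _ hf x
  have m1 : gm e1 e0 f x = ⟪f1, W⟫ := rfl
  have m2 : gm e2 e0 f x = ⟪f2, W⟫ := rfl
  have P1 : DD e1 (PP1 e0 e1 e2 f) x = 2 * a122 * ⟪f1, W⟫
      + g22 * (⟪f11, W⟫ + ⟪f1, DD e1 (DD e0 f) x⟫) - ((a112 + a121) * ⟪f2, W⟫
      + g12 * (⟪f12, W⟫ + ⟪f2, DD e1 (DD e0 f) x⟫)) := by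
    have : PP1 e0 e1 e2 f = fun x => gm e2 e2 f x * gm e1 e0 f x - gm e1 e2 f x * gm e2 e0 f x := rfl
    rw [this, DD_sub _ (by fun_prop) (by fun_prop), DD_mul _ (by fun_prop) (by fun_prop),
      DD_mul _ (by fun_prop) (by fun_prop), d1g22, d1g12, h10, h20, m1, m2]
  have P2 : DD e2 (PP2 e0 e1 e2 f) x = 2 * a121 * ⟪f2, W⟫
      + g11 * (⟪f22, W⟫ + ⟪f2, DD e2 (DD e0 f) x⟫) - ((a122 + a221) * ⟪f1, W⟫
      + g12 * (⟪f12, W⟫ + ⟪f1, DD e2 (DD e0 f) x⟫)) := by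
    have : PP2 e0 e1 e2 f = fun x => gm e1 e1 f x * gm e2 e0 f x - gm e1 e2 f x * gm e1 e0 f x := rfl
    rw [this, DD_sub _ (by fun_prop) (by fun_prop), DD_mul _ (by fun_prop) (by fun_prop),
      DD_mul _ (by fun_prop) (by fun_prop), d2g11, d2g12, k10, k20, m1, m2]
  have hG0 : DD e0 (GG e1 e2 f) x = 2 * (g22 * ⟪f1, DD e1 (DD e0 f) x⟫
      - g12 * ⟪f2, DD e1 (DD e0 f) x⟫ + g11 * ⟪f2, DD e2 (DD e0 f) x⟫
      - g12 * ⟪f1, DD e2 (DD e0 f) x⟫) := by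
    rw [DD_GG _ _ _ hf, DD_gm _ _ _ hf, DD_gm _ _ _ hf, DD_gm _ _ _ hf, DD_comm e0 e1 hf,
      DD_comm e0 e2 hf, real_inner_comm f1 (DD e1 (DD e0 f) x),
      real_inner_comm f2 (DD e2 (DD e0 f) x), real_inner_comm f2 (DD e1 (DD e0 f) x)]
    ring
  rw [hG0] at q0
  rw [P1] at x1
  rw [P2] at x2
  have PP1v : PP1 e0 e1 e2 f x = g22 * ⟪f1, W⟫ - g12 * ⟪f2, W⟫ := rfl
  have PP2v : PP2 e0 e1 e2 f x = g11 * ⟪f2, W⟫ - g12 * ⟪f1, W⟫ := rfl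
  rw [PP1v] at X1
  rw [PP2v] at X2
  have hne : 2 * F * G ≠ 0 := mul_ne_zero (by positivity) hGx
  apply mul_left_cancel₀ hne
  clear_value U
  clear hU hU1 hU2
  -- replace `F * DD F` by `D/2`
  have y1 : 2 * G * F * DD e1 (XX1 e0 e1 e2 f) x = 2 * G * (2 * a122 * ⟪f1, W⟫
      + g22 * (⟪f11, W⟫ + ⟪f1, DD e1 (DD e0 f) x⟫) - ((a112 + a121) * ⟪f2, W⟫
      + g12 * (⟪f12, W⟫ + ⟪f2, DD e1 (DD e0 f) x⟫))) - D1 * (g22 * ⟪f1, W⟫ - g12 * ⟪f2, W⟫) := by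
    linear_combination 2 * G * x1 - 2 * DD e1 (FF e1 e2 f) x * XX1 e0 e1 e2 f x * (-hFF)
      - D1 * X1 - F * XX1 e0 e1 e2 f x * q1
  have y2 : 2 * G * F * DD e2 (XX2 e0 e1 e2 f) x = 2 * G * (2 * a121 * ⟪f2, W⟫
      + g11 * (⟪f22, W⟫ + ⟪f2, DD e2 (DD e0 f) x⟫) - ((a122 + a221) * ⟪f1, W⟫
      + g12 * (⟪f12, W⟫ + ⟪f1, DD e2 (DD e0 f) x⟫))) - D2 * (g11 * ⟪f2, W⟫ - g12 * ⟪f1, W⟫) := by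
    linear_combination 2 * G * x2 - 2 * DD e2 (FF e1 e2 f) x * XX2 e0 e1 e2 f x * (-hFF)
      - D2 * X2 - F * XX2 e0 e1 e2 f x * q2
  linear_combination G * q0 - y1 - y2 - hUW + 2 * G * ⟪N x, W⟫ * hH
    + 4 * G * HH e1 e2 f N x * ⟪N x, W⟫ * hFF

end fv

end SV

namespace SV

open Set Filter Topology
open scoped ContDiff

section kk

variable {V : Type*} [NormedAddCommGroup V] [NormedSpace ℝ V]

/-- numerator of the pairing -/
def KN (Q₁ Q₂ : ℝ) (e1 e2 : V) (f N : V → RR4) (x : V) : ℝ :=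
  (2 * Q₁ * gm e2 e2 f x ^ 2 + 4 * Q₂ * gm e2 e2 f x * gm e1 e2 f x - 2 * Q₁ * gm e1 e2 f x ^ 2)
      * (Lm e1 e1 f N x - HH e1 e2 f N x * gm e1 e1 f x)
    + 2 * (-gm e1 e2 f x * (2 * Q₁ * gm e2 e2 f x + 2 * Q₂ * gm e1 e2 f x)
        + gm e1 e1 f x * (-2 * Q₂ * gm e2 e2 f x + 2 * Q₁ * gm e1 e2 f x))
      * (Lm e1 e2 f N x - HH e1 e2 f N x * gm e1 e2 f x)
    + (2 * Q₁ * gm e1 e2 f x ^ 2 + 4 * Q₂ * gm e1 e1 f x * gm e1 e2 f x - 2 * Q₁ * gm e1 e1 f x ^ 2)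
      * (Lm e2 e2 f N x - HH e1 e2 f N x * gm e2 e2 f x)

/-- the pairing of the quadratic differential with the trace-free second fundamental form -/
def KK (Q₁ Q₂ : ℝ) (e1 e2 : V) (f N : V → RR4) (x : V) : ℝ :=
  KN Q₁ Q₂ e1 e2 f N x / GG e1 e2 f x ^ 2

variable {f N : V → RR4}

lemma KN_smooth (Q₁ Q₂ : ℝ) {e1 e2 : V} (hf : ContDiff ℝ ∞ f) (hN : ContDiff ℝ ∞ N)
    (hG : ∀ x, 0 < GG e1 e2 f x) : ContDiff ℝ ∞ (KN Q₁ Q₂ e1 e2 f N) := by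
  have := HH_smooth hf hN hG
  unfold KN; fun_prop

lemma KK_smooth (Q₁ Q₂ : ℝ) {e1 e2 : V} (hf : ContDiff ℝ ∞ f) (hN : ContDiff ℝ ∞ N)
    (hG : ∀ x, 0 < GG e1 e2 f x) : ContDiff ℝ ∞ (KK Q₁ Q₂ e1 e2 f N) := by
  have := KN_smooth Q₁ Q₂ hf hN hG
  unfold KK
  refine ContDiff.div this (by fun_prop) fun x => ?_
  have := hG x; positivity

end kk

lemma gmat_det (f : RR2 → RR4) (x : RR2) : (gmat f x).det = GG (1, 0) (0, 1) f x := by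
  have h11 : (⟪d1 f x, d1 f x⟫ : ℝ) = gm (1, 0) (1, 0) f x := rfl
  have h12 : (⟪d1 f x, d2 f x⟫ : ℝ) = gm (1, 0) (0, 1) f x := rfl
  have h21 : (⟪d2 f x, d1 f x⟫ : ℝ) = gm (1, 0) (0, 1) f x := real_inner_comm _ _
  have h22 : (⟪d2 f x, d2 f x⟫ : ℝ) = gm (0, 1) (0, 1) f x := rfl
  unfold gmat GG
  rw [Matrix.det_fin_two_of, h11, h12, h21, h22]; ring

lemma gmat_inv (f : RR2 → RR4) (x : RR2) : (gmat f x)⁻¹ =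
    !![(GG (1, 0) (0, 1) f x)⁻¹ * gm (0, 1) (0, 1) f x,
       -((GG (1, 0) (0, 1) f x)⁻¹ * gm (1, 0) (0, 1) f x);
       -((GG (1, 0) (0, 1) f x)⁻¹ * gm (1, 0) (0, 1) f x),
       (GG (1, 0) (0, 1) f x)⁻¹ * gm (1, 0) (1, 0) f x] := by
  have h11 : (⟪d1 f x, d1 f x⟫ : ℝ) = gm (1, 0) (1, 0) f x := rfl
  have h12 : (⟪d1 f x, d2 f x⟫ : ℝ) = gm (1, 0) (0, 1) f x := rfl
  have h21 : (⟪d2 f x, d1 f x⟫ : ℝ) = gm (1, 0) (0, 1) f x := real_inner_comm _ _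
  have h22 : (⟪d2 f x, d2 f x⟫ : ℝ) = gm (0, 1) (0, 1) f x := rfl
  rw [Matrix.inv_def, gmat_det, Ring.inverse_eq_inv']
  unfold gmat
  rw [Matrix.adjugate_fin_two_of, h11, h12, h21, h22]
  ext i j
  fin_cases i <;> fin_cases j <;> simp

lemma qPairing_eq (Q₁ Q₂ : ℝ) (f N : RR2 → RR4) (x : RR2) (hG : GG (1, 0) (0, 1) f x ≠ 0) :
    qPairing Q₁ Q₂ f N x = KK Q₁ Q₂ (1, 0) (0, 1) f N x := by
  have h11 : (⟪d1 f x, d1 f x⟫ : ℝ) = gm (1, 0) (1, 0) f x := rfl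
  have h12 : (⟪d1 f x, d2 f x⟫ : ℝ) = gm (1, 0) (0, 1) f x := rfl
  have h21 : (⟪d2 f x, d1 f x⟫ : ℝ) = gm (1, 0) (0, 1) f x := real_inner_comm _ _
  have h22 : (⟪d2 f x, d2 f x⟫ : ℝ) = gm (0, 1) (0, 1) f x := rfl
  have l11 : I11 f N x = Lm (1, 0) (1, 0) f N x := rfl
  have l12 : I12 f N x = Lm (1, 0) (0, 1) f N x := rfl
  have l22 : I22 f N x = Lm (0, 1) (0, 1) f N x := rfl
  have hH : Hgen f N x = HH (1, 0) (0, 1) f N x := by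
    unfold Hgen HH Imat
    rw [gmat_inv, l11, l12, l22]
    simp [Fin.sum_univ_two]
    field_simp
    ring
  unfold qPairing I0mat KK KN
  rw [gmat_inv, hH]
  unfold Imat gmat qbar
  rw [l11, l12, l22, h11, h12, h21, h22]
  simp [Fin.sum_univ_two]
  field_simp
  ring

section slice

variable {f N : ℝ × RR2 → RR4} (t : ℝ) (x : RR2)

lemma gm_slice (hf : ContDiff ℝ ∞ f) (a b : RR2) :
    gm a b (fun y => f (t, y)) x = gm ((0 : ℝ), a) ((0 : ℝ), b) f (t, x) := by
  unfold gm; rw [DD_slice hf, DD_slice hf]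

lemma Lm_slice (hf : ContDiff ℝ ∞ f) (a b : RR2) :
    Lm a b (fun y => f (t, y)) (fun y => N (t, y)) x
      = Lm ((0 : ℝ), a) ((0 : ℝ), b) f N (t, x) := by
  unfold Lm; rw [DD_slice hf, DD_slice (DD_contDiff _ hf)]

lemma GG_slice (hf : ContDiff ℝ ∞ f) (a b : RR2) :
    GG a b (fun y => f (t, y)) x = GG ((0 : ℝ), a) ((0 : ℝ), b) f (t, x) := by
  unfold GG; simp only [gm_slice t x hf]

lemma KK_slice (hf : ContDiff ℝ ∞ f) (Q₁ Q₂ : ℝ) (a b : RR2) :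
    KK Q₁ Q₂ a b (fun y => f (t, y)) (fun y => N (t, y)) x
      = KK Q₁ Q₂ ((0 : ℝ), a) ((0 : ℝ), b) f N (t, x) := by
  unfold KK KN HH; simp only [gm_slice t x hf, Lm_slice t x hf, GG_slice t x hf]

end slice

end SV

namespace SV

open Set Filter Topology
open scoped ContDiff

/-- the standard directions of the plane -/
abbrev b1 : RR2 := (1, 0)
/-- the standard directions of the plane -/
abbrev b2 : RR2 := (0, 1)

/-- conformal immersion data, in global form -/
structure CG (f n : RR2 → RR4) (lam : RR2 → ℝ) : Prop where
  hf : ContDiff ℝ ∞ f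
  hn : ContDiff ℝ ∞ n
  hl : ContDiff ℝ ∞ lam
  ff : ∀ x, (⟪f x, f x⟫ : ℝ) = 1
  g11 : ∀ x, (⟪DD b1 f x, DD b1 f x⟫ : ℝ) = Real.exp (2 * lam x)
  g22 : ∀ x, (⟪DD b2 f x, DD b2 f x⟫ : ℝ) = Real.exp (2 * lam x)
  g12 : ∀ x, (⟪DD b1 f x, DD b2 f x⟫ : ℝ) = 0
  nn : ∀ x, (⟪n x, n x⟫ : ℝ) = 1
  nf : ∀ x, (⟪n x, f x⟫ : ℝ) = 0
  n1 : ∀ x, (⟪n x, DD b1 f x⟫ : ℝ) = 0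
  n2 : ∀ x, (⟪n x, DD b2 f x⟫ : ℝ) = 0
  det : ∀ x, 0 < det4 (f x) (DD b1 f x) (DD b2 f x) (n x)

/-- differentiate a constant inner product -/
lemma DD_inner_const {V : Type*} [NormedAddCommGroup V] [NormedSpace ℝ V] (e : V) {f g : V → RR4}
    (hf : ContDiff ℝ ∞ f) (hg : ContDiff ℝ ∞ g) {c : ℝ}
    (h : ∀ x, (⟪f x, g x⟫ : ℝ) = c) (x : V) :
    (⟪DD e f x, g x⟫ : ℝ) + ⟪f x, DD e g x⟫ = 0 := by
  rw [← DD_inner e hf hg x, show (fun y => (⟪f y, g y⟫ : ℝ)) = fun _ => c from funext h, DD_const]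

lemma DD_E {lam : RR2 → ℝ} (hl : ContDiff ℝ ∞ lam) (e : RR2) (x : RR2) :
    DD e (fun y => Real.exp (2 * lam y)) x = 2 * DD e lam x * Real.exp (2 * lam x) := by
  rw [DD_exp e (by fun_prop), DD_cmul e 2 hl]; ring

namespace CG

variable {f n : RR2 → RR4} {lam : RR2 → ℝ}

lemma ff_e (h : CG f n lam) (e : RR2) (x : RR2) : (⟪f x, DD e f x⟫ : ℝ) = 0 := by
  have := DD_inner_const e h.hf h.hf h.ff x
  rw [real_inner_comm] at this; linarith

lemma ff_ee (h : CG f n lam) (e e' : RR2) (x : RR2) :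
    (⟪DD e (DD e' f) x, f x⟫ : ℝ) = - ⟪DD e f x, DD e' f x⟫ := by
  have := DD_inner_const e h.hf (DD_contDiff e' h.hf) (h.ff_e e') x
  rw [real_inner_comm] ; linarith

lemma n_e (h : CG f n lam) (e : RR2) (x : RR2) : (⟪DD e n x, n x⟫ : ℝ) = 0 := by
  have := DD_inner_const e h.hn h.hn h.nn x
  rw [real_inner_comm (DD e n x) (n x)] at this; linarith

lemma nf_e1 (h : CG f n lam) (x : RR2) : (⟪DD b1 n x, f x⟫ : ℝ) = 0 := by
  have := DD_inner_const b1 h.hn h.hf h.nf x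
  rw [h.n1] at this; linarith

lemma nf_e2 (h : CG f n lam) (x : RR2) : (⟪DD b2 n x, f x⟫ : ℝ) = 0 := by
  have := DD_inner_const b2 h.hn h.hf h.nf x
  rw [h.n2] at this; linarith

lemma n1_e (h : CG f n lam) (e : RR2) (x : RR2) : (⟪DD e n x, DD b1 f x⟫ : ℝ) = - ⟪n x, DD e (DD b1 f) x⟫ := by
  have := DD_inner_const e h.hn (DD_contDiff b1 h.hf) h.n1 x
  linarith

lemma n2_e (h : CG f n lam) (e : RR2) (x : RR2) : (⟪DD e n x, DD b2 f x⟫ : ℝ) = - ⟪n x, DD e (DD b2 f) x⟫ := by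
  have := DD_inner_const e h.hn (DD_contDiff b2 h.hf) h.n2 x
  linarith

lemma c11 (h : CG f n lam) (e : RR2) (x : RR2) : (⟪DD e (DD b1 f) x, DD b1 f x⟫ : ℝ)
    = Real.exp (2 * lam x) * DD e lam x := by
  have h1 := DD_inner e (DD_contDiff b1 h.hf) (DD_contDiff b1 h.hf) x
  rw [show (fun y => (⟪DD b1 f y, DD b1 f y⟫ : ℝ)) = fun y => Real.exp (2 * lam y) from funext h.g11,
    DD_E h.hl, real_inner_comm (DD e (DD b1 f) x) (DD b1 f x)] at h1
  linarith

lemma c22 (h : CG f n lam) (e : RR2) (x : RR2) : (⟪DD e (DD b2 f) x, DD b2 f x⟫ : ℝ)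
    = Real.exp (2 * lam x) * DD e lam x := by
  have h1 := DD_inner e (DD_contDiff b2 h.hf) (DD_contDiff b2 h.hf) x
  rw [show (fun y => (⟪DD b2 f y, DD b2 f y⟫ : ℝ)) = fun y => Real.exp (2 * lam y) from funext h.g22,
    DD_E h.hl, real_inner_comm (DD e (DD b2 f) x) (DD b2 f x)] at h1
  linarith

lemma sw (h : CG f n lam) (x : RR2) : DD b2 (DD b1 f) x = DD b1 (DD b2 f) x := DD_comm _ _ h.hf x

/-- `⟨f₁₁, f₂⟩` -/
lemma c112 (h : CG f n lam) (x : RR2) : (⟪DD b1 (DD b1 f) x, DD b2 f x⟫ : ℝ)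
    = - (Real.exp (2 * lam x) * DD b2 lam x) := by
  have h1 := DD_inner_const b1 (DD_contDiff b1 h.hf) (DD_contDiff b2 h.hf) h.g12 x
  rw [← h.sw, real_inner_comm (DD b2 (DD b1 f) x) (DD b1 f x), h.c11] at h1
  linarith

/-- `⟨f₂₂, f₁⟩` -/
lemma c221 (h : CG f n lam) (x : RR2) : (⟪DD b2 (DD b2 f) x, DD b1 f x⟫ : ℝ)
    = - (Real.exp (2 * lam x) * DD b1 lam x) := by
  have h1 := DD_inner_const b2 (DD_contDiff b1 h.hf) (DD_contDiff b2 h.hf) h.g12 x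
  rw [h.sw, h.c22, real_inner_comm (DD b2 (DD b2 f) x) (DD b1 f x)] at h1
  linarith

/-- expansion of inner products in the moving frame -/
lemma pv (h : CG f n lam) (x : RR2) (a b : RR4) : (⟪a, b⟫ : ℝ) = ⟪a, f x⟫ * ⟪b, f x⟫
    + (Real.exp (2 * lam x))⁻¹ * (⟪a, DD b1 f x⟫ * ⟪b, DD b1 f x⟫
      + ⟪a, DD b2 f x⟫ * ⟪b, DD b2 f x⟫) + ⟪a, n x⟫ * ⟪b, n x⟫ :=
  parseval (Real.exp_pos _).ne' (h.det x) (h.ff x) (h.g11 x) (h.g22 x) (h.g12 x) (h.ff_e _ x)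
    (h.ff_e _ x) (h.nn x) (h.nf x) (h.n1 x) (h.n2 x)

/-- Codazzi 1 -/
lemma codazzi1 (h : CG f n lam) (x : RR2) : DD b1 (Lm b1 b2 f n) x - DD b2 (Lm b1 b1 f n) x
    = - DD b2 lam x * (Lm b1 b1 f n x + Lm b2 b2 f n x) := by
  have hf := h.hf
  have e1 : DD b1 (Lm b1 b2 f n) x = ⟪DD b1 n x, DD b2 (DD b1 f) x⟫
      + ⟪n x, DD b1 (DD b2 (DD b1 f)) x⟫ := DD_inner b1 h.hn (by fun_prop) x
  have e2 : DD b2 (Lm b1 b1 f n) x = ⟪DD b2 n x, DD b1 (DD b1 f) x⟫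
      + ⟪n x, DD b2 (DD b1 (DD b1 f)) x⟫ := DD_inner b2 h.hn (by fun_prop) x
  rw [DD_comm b1 b2 (f := DD b1 f) (by fun_prop)] at e1
  rw [h.pv x (DD b1 n x)] at e1
  rw [h.pv x (DD b2 n x)] at e2
  rw [e1, e2]
  simp only [h.nf_e1, h.nf_e2, h.n_e, h.n1_e, h.n2_e, h.c11, h.c112]
  simp only [h.sw, h.c22]
  unfold Lm
  have := (Real.exp_pos (2 * lam x)).ne'
  field_simp
  ring

/-- Codazzi 2 -/
lemma codazzi2 (h : CG f n lam) (x : RR2) : DD b1 (Lm b2 b2 f n) x - DD b2 (Lm b1 b2 f n) x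
    = DD b1 lam x * (Lm b1 b1 f n x + Lm b2 b2 f n x) := by
  have hf := h.hf
  have e1 : DD b1 (Lm b2 b2 f n) x = ⟪DD b1 n x, DD b2 (DD b2 f) x⟫
      + ⟪n x, DD b1 (DD b2 (DD b2 f)) x⟫ := DD_inner b1 h.hn (by fun_prop) x
  have hs : DD b2 (DD b1 f) = DD b1 (DD b2 f) := funext h.sw
  have e2 : DD b2 (Lm b1 b2 f n) x = ⟪DD b2 n x, DD b1 (DD b2 f) x⟫
      + ⟪n x, DD b2 (DD b1 (DD b2 f)) x⟫ := by
    rw [← hs]; exact DD_inner b2 h.hn (by fun_prop) x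
  rw [DD_comm b1 b2 (f := DD b2 f) (by fun_prop)] at e1
  rw [h.pv x (DD b1 n x)] at e1
  rw [h.pv x (DD b2 n x)] at e2
  rw [e1, e2]
  have c121 : (⟪DD b1 (DD b2 f) x, DD b1 f x⟫ : ℝ) = Real.exp (2 * lam x) * DD b2 lam x := by
    rw [← h.sw, h.c11]
  simp only [h.nf_e1, h.nf_e2, h.n_e, h.n1_e, h.n2_e, h.c22, h.c221, c121, h.sw]
  unfold Lm
  have := (Real.exp_pos (2 * lam x)).ne'
  field_simp
  ring

end CG

end SV

namespace SV

open Set Filter Topology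
open scoped ContDiff

/-- time direction -/
abbrev et : ℝ × RR2 := ((1 : ℝ), (0 : RR2))
/-- first space direction -/
abbrev s1 : ℝ × RR2 := ((0 : ℝ), b1)
/-- second space direction -/
abbrev s2 : ℝ × RR2 := ((0 : ℝ), b2)

namespace CG

variable {f n : RR2 → RR4} {lam : RR2 → ℝ}

lemma L21 (h : CG f n lam) (x : RR2) : (⟪n x, DD b1 (DD b2 f) x⟫ : ℝ) = Lm b1 b2 f n x := by
  unfold Lm; rw [h.sw]

/-- normal component of the derivative of the variation field -/
lemma p_eq (h : CG f n lam) {w : RR2 → RR4} {σ₁ σ₂ v : RR2 → ℝ} (hws : ContDiff ℝ ∞ w)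
    (hw : ∀ x, w x = σ₁ x • DD b1 f x + σ₂ x • DD b2 f x + v x • n x) (a : RR2) (x : RR2) :
    (⟪n x, DD a w x⟫ : ℝ) = DD a v x + σ₁ x * ⟪n x, DD a (DD b1 f) x⟫
      + σ₂ x * ⟪n x, DD a (DD b2 f) x⟫ := by
  have h1 := DD_inner a h.hn hws x
  have h2 : (fun y => (⟪n y, w y⟫ : ℝ)) = v := by
    funext y
    rw [hw]
    simp only [inner_add_right, real_inner_smul_right, h.n1, h.n2, h.nn]; ring
  rw [h2] at h1
  have h3 : (⟪DD a n x, w x⟫ : ℝ) = - (σ₁ x * ⟪n x, DD a (DD b1 f) x⟫)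
      - σ₂ x * ⟪n x, DD a (DD b2 f) x⟫ := by
    rw [hw]
    simp only [inner_add_right, real_inner_smul_right, h.n1_e, h.n2_e, h.n_e]; ring
  linarith

lemma m1_eq (h : CG f n lam) {w : RR2 → RR4} {σ₁ σ₂ v : RR2 → ℝ} (hws : ContDiff ℝ ∞ w)
    (hσ₁ : ContDiff ℝ ∞ σ₁)
    (hw : ∀ x, w x = σ₁ x • DD b1 f x + σ₂ x • DD b2 f x + v x • n x) (a : RR2) (x : RR2) :
    (⟪DD a w x, DD b1 f x⟫ : ℝ) = 2 * DD a lam x * Real.exp (2 * lam x) * σ₁ x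
      + Real.exp (2 * lam x) * DD a σ₁ x - σ₁ x * ⟪DD a (DD b1 f) x, DD b1 f x⟫
      - σ₂ x * ⟪DD a (DD b1 f) x, DD b2 f x⟫ - v x * ⟪n x, DD a (DD b1 f) x⟫ := by
  have h1 := DD_inner a hws (DD_contDiff b1 h.hf) x
  have h2 : (fun y => (⟪w y, DD b1 f y⟫ : ℝ)) = fun y => Real.exp (2 * lam y) * σ₁ y := by
    funext y
    rw [hw]
    have g21 : (⟪DD b2 f y, DD b1 f y⟫ : ℝ) = 0 := by rw [real_inner_comm]; exact h.g12 y
    simp only [inner_add_left, real_inner_smul_left, h.n1, h.g11, g21]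
    ring
  have hl := h.hl
  rw [h2, DD_mul a (by fun_prop) hσ₁, DD_E h.hl] at h1
  have h3 : (⟪w x, DD a (DD b1 f) x⟫ : ℝ) = σ₁ x * ⟪DD a (DD b1 f) x, DD b1 f x⟫
      + σ₂ x * ⟪DD a (DD b1 f) x, DD b2 f x⟫ + v x * ⟪n x, DD a (DD b1 f) x⟫ := by
    rw [hw]
    simp only [inner_add_left, real_inner_smul_left]
    rw [real_inner_comm (DD b1 f x), real_inner_comm (DD b2 f x)]
  linarith

lemma m2_eq (h : CG f n lam) {w : RR2 → RR4} {σ₁ σ₂ v : RR2 → ℝ} (hws : ContDiff ℝ ∞ w)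
    (hσ₂ : ContDiff ℝ ∞ σ₂)
    (hw : ∀ x, w x = σ₁ x • DD b1 f x + σ₂ x • DD b2 f x + v x • n x) (a : RR2) (x : RR2) :
    (⟪DD a w x, DD b2 f x⟫ : ℝ) = 2 * DD a lam x * Real.exp (2 * lam x) * σ₂ x
      + Real.exp (2 * lam x) * DD a σ₂ x - σ₁ x * ⟪DD a (DD b2 f) x, DD b1 f x⟫
      - σ₂ x * ⟪DD a (DD b2 f) x, DD b2 f x⟫ - v x * ⟪n x, DD a (DD b2 f) x⟫ := by
  have h1 := DD_inner a hws (DD_contDiff b2 h.hf) x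
  have h2 : (fun y => (⟪w y, DD b2 f y⟫ : ℝ)) = fun y => Real.exp (2 * lam y) * σ₂ y := by
    funext y
    rw [hw]
    simp only [inner_add_left, real_inner_smul_left, h.n2, h.g22, h.g12]
    ring
  have hl := h.hl
  rw [h2, DD_mul a (by fun_prop) hσ₂, DD_E h.hl] at h1
  have h3 : (⟪w x, DD a (DD b2 f) x⟫ : ℝ) = σ₁ x * ⟪DD a (DD b2 f) x, DD b1 f x⟫
      + σ₂ x * ⟪DD a (DD b2 f) x, DD b2 f x⟫ + v x * ⟪n x, DD a (DD b2 f) x⟫ := by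
    rw [hw]
    simp only [inner_add_left, real_inner_smul_left]
    rw [real_inner_comm (DD b1 f x), real_inner_comm (DD b2 f x)]
  linarith

/-- derivative of the normal component -/
lemma n_ww (h : CG f n lam) {w : RR2 → RR4} (hws : ContDiff ℝ ∞ w) (a b : RR2) (x : RR2)
    (p : RR2 → ℝ) (hp : ∀ y, (⟪n y, DD a w y⟫ : ℝ) = p y) :
    (⟪n x, DD b (DD a w) x⟫ : ℝ) = DD b p x - ⟪DD b n x, DD a w x⟫ := by
  have h1 := DD_inner b h.hn (DD_contDiff a hws) x
  rw [show (fun y => (⟪n y, DD a w y⟫ : ℝ)) = p from funext hp] at h1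
  linarith

end CG

/-- time derivative of the second fundamental form -/
lemma Dt_Lm {F N : ℝ × RR2 → RR4} (hF : ContDiff ℝ ∞ F) (hN : ContDiff ℝ ∞ N)
    (a b : RR2) (x : RR2) :
    DD et (Lm ((0 : ℝ), a) ((0 : ℝ), b) F N) (0, x)
      = ⟪DD et N (0, x), DD b (DD a (fun y => F (0, y))) x⟫
        + ⟪N (0, x), DD b (DD a (fun y => DD et F (0, y))) x⟫ := by
  have h1 : DD et (Lm ((0 : ℝ), a) ((0 : ℝ), b) F N) (0, x) = _ :=
    DD_inner et hN (DD_contDiff ((0 : ℝ), b) (DD_contDiff ((0 : ℝ), a) hF)) (0, x)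
  rw [h1, DD_comm et ((0 : ℝ), b) (by fun_prop),
    show DD et (DD ((0 : ℝ), a) F) = DD ((0 : ℝ), a) (DD et F) from funext fun y => DD_comm _ _ hF y]
  rw [DD_slice hF, DD_slice (DD_contDiff _ hF), DD_slice (DD_contDiff _ hF),
    DD_slice (DD_contDiff _ (DD_contDiff _ hF))]

/-- time derivative of the metric -/
lemma Dt_gm {F : ℝ × RR2 → RR4} (hF : ContDiff ℝ ∞ F) (a b : RR2) (x : RR2) :
    DD et (gm ((0 : ℝ), a) ((0 : ℝ), b) F) (0, x)
      = ⟪DD a (fun y => DD et F (0, y)) x, DD b (fun y => F (0, y)) x⟫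
        + ⟪DD b (fun y => DD et F (0, y)) x, DD a (fun y => F (0, y)) x⟫ := by
  rw [DD_gm _ _ _ hF, DD_comm et ((0 : ℝ), a) hF, DD_comm et ((0 : ℝ), b) hF]
  rw [DD_slice hF, DD_slice hF, DD_slice (DD_contDiff _ hF), DD_slice (DD_contDiff _ hF)]
  simp only []
  rw [real_inner_comm (DD ((0 : ℝ), a) F (0, x))]

set_option linter.unusedSimpArgs false in
/-- the full collection of first variations at time zero -/
lemma variations {f n : RR2 → RR4} {lam : RR2 → ℝ} (h : CG f n lam)
    {σ₁ σ₂ v : RR2 → ℝ} (hσ₁ : ContDiff ℝ ∞ σ₁) (hσ₂ : ContDiff ℝ ∞ σ₂) (hv : ContDiff ℝ ∞ v)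
    {F N : ℝ × RR2 → RR4} (hF : ContDiff ℝ ∞ F) (hN : ContDiff ℝ ∞ N)
    (hNN : ∀ p, (⟪N p, N p⟫ : ℝ) = 1) (hNF : ∀ p, (⟪N p, F p⟫ : ℝ) = 0)
    (hN1 : ∀ p, (⟪N p, DD s1 F p⟫ : ℝ) = 0) (hN2 : ∀ p, (⟪N p, DD s2 F p⟫ : ℝ) = 0)
    (hF0 : ∀ x, F (0, x) = f x) (hN0 : ∀ x, N (0, x) = n x)
    (hw : ∀ x, DD et F (0, x) = σ₁ x • DD b1 f x + σ₂ x • DD b2 f x + v x • n x) (x : RR2)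
    {E l1 l2 L11 L12 L22 p1 p2 m11 m12 m21 m22 : ℝ}
    (hE : E = Real.exp (2 * lam x)) (hl1 : l1 = DD b1 lam x) (hl2 : l2 = DD b2 lam x)
    (hL11 : L11 = Lm b1 b1 f n x) (hL12 : L12 = Lm b1 b2 f n x) (hL22 : L22 = Lm b2 b2 f n x)
    (hp1 : p1 = DD b1 v x + σ₁ x * L11 + σ₂ x * L12)
    (hp2 : p2 = DD b2 v x + σ₁ x * L12 + σ₂ x * L22)
    (hm11 : m11 = E * DD b1 σ₁ x + E * (l1 * σ₁ x + l2 * σ₂ x) - v x * L11)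
    (hm12 : m12 = E * DD b1 σ₂ x + E * (l1 * σ₂ x - l2 * σ₁ x) - v x * L12)
    (hm21 : m21 = E * DD b2 σ₁ x + E * (l2 * σ₁ x - l1 * σ₂ x) - v x * L12)
    (hm22 : m22 = E * DD b2 σ₂ x + E * (l1 * σ₁ x + l2 * σ₂ x) - v x * L22) :
    DD et (gm s1 s1 F) (0, x) = 2 * m11 ∧ DD et (gm s2 s2 F) (0, x) = 2 * m22 ∧
    DD et (gm s1 s2 F) (0, x) = m12 + m21 ∧
    E * DD et (Lm s1 s1 F N) (0, x) = v x * E ^ 2 - E * (l1 * p1 - l2 * p2)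
      + E * (DD b1 (DD b1 v) x + DD b1 σ₁ x * L11 + DD b1 σ₂ x * L12
        + σ₁ x * DD b1 (Lm b1 b1 f n) x + σ₂ x * DD b1 (Lm b1 b2 f n) x)
      + L11 * m11 + L12 * m12 ∧
    E * DD et (Lm s1 s2 F N) (0, x) = - E * (l2 * p1 + l1 * p2)
      + E * (DD b2 (DD b1 v) x + DD b2 σ₁ x * L11 + DD b2 σ₂ x * L12
        + σ₁ x * DD b2 (Lm b1 b1 f n) x + σ₂ x * DD b2 (Lm b1 b2 f n) x)
      + L12 * m11 + L22 * m12 ∧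
    E * DD et (Lm s2 s2 F N) (0, x) = v x * E ^ 2 - E * (- l1 * p1 + l2 * p2)
      + E * (DD b2 (DD b2 v) x + DD b2 σ₁ x * L12 + DD b2 σ₂ x * L22
        + σ₁ x * DD b2 (Lm b1 b2 f n) x + σ₂ x * DD b2 (Lm b2 b2 f n) x)
      + L12 * m21 + L22 * m22 := by
  have hf := h.hf
  have hn := h.hn
  set w : RR2 → RR4 := fun y => DD et F (0, y) with hwdef
  have hws : ContDiff ℝ ∞ w := by
    have := DD_contDiff et hF
    fun_prop
  have hFf : (fun y => F (0, y)) = f := funext hF0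
  have hNn : (fun y => N (0, y)) = n := funext hN0
  have hE0 : E ≠ 0 := by rw [hE]; positivity
  have c121 : (⟪DD b1 (DD b2 f) x, DD b1 f x⟫ : ℝ) = Real.exp (2 * lam x) * DD b2 lam x := by
    rw [← h.sw, h.c11]
  have l11 : (⟪n x, DD b1 (DD b1 f) x⟫ : ℝ) = L11 := hL11.symm
  have l12 : (⟪n x, DD b1 (DD b2 f) x⟫ : ℝ) = L12 := by rw [h.L21, hL12]
  have l22 : (⟪n x, DD b2 (DD b2 f) x⟫ : ℝ) = L22 := hL22.symm
  -- tangential components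
  have k11 : (⟪DD b1 w x, DD b1 f x⟫ : ℝ) = m11 := by
    rw [h.m1_eq hws hσ₁ hw, h.c11, h.c112, l11, hm11, hE, hl1, hl2]; ring
  have k21 : (⟪DD b2 w x, DD b1 f x⟫ : ℝ) = m21 := by
    rw [h.m1_eq hws hσ₁ hw, h.sw, c121, h.c22, l12, hm21, hE, hl1, hl2]; ring
  have k12 : (⟪DD b1 w x, DD b2 f x⟫ : ℝ) = m12 := by
    rw [h.m2_eq hws hσ₂ hw, c121, h.c22, l12, hm12, hE, hl1, hl2]; ring
  have k22 : (⟪DD b2 w x, DD b2 f x⟫ : ℝ) = m22 := by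
    rw [h.m2_eq hws hσ₂ hw, h.c221, h.c22, l22, hm22, hE, hl1, hl2]; ring
  -- normal components
  have P1 : ∀ y, (⟪n y, DD b1 w y⟫ : ℝ)
      = DD b1 v y + σ₁ y * Lm b1 b1 f n y + σ₂ y * Lm b1 b2 f n y := by
    intro y; rw [h.p_eq hws hw, h.L21]; rfl
  have P2 : ∀ y, (⟪n y, DD b2 w y⟫ : ℝ)
      = DD b2 v y + σ₁ y * Lm b1 b2 f n y + σ₂ y * Lm b2 b2 f n y := by
    intro y; rw [h.p_eq hws hw]; rfl
  have P1x : (⟪n x, DD b1 w x⟫ : ℝ) = p1 := by rw [P1, hp1, hL11, hL12]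
  have P2x : (⟪n x, DD b2 w x⟫ : ℝ) = p2 := by rw [P2, hp2, hL22, hL12]
  -- derivative of the normal
  have t0 : (⟪DD et N (0, x), f x⟫ : ℝ) = - v x := by
    have := DD_inner_const et hN hF hNF (0, x)
    rw [hF0, hN0, hw] at this
    simp only [inner_add_right, real_inner_smul_right, h.n1, h.n2, h.nn] at this
    linarith
  have t1 : (⟪DD et N (0, x), DD b1 f x⟫ : ℝ) = - p1 := by
    have := DD_inner_const et hN (DD_contDiff s1 hF) hN1 (0, x)
    rw [DD_comm et s1 hF] at this
    have e1 : DD b1 f x = DD s1 F (0, x) := by rw [← hFf, DD_slice hF]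
    have e2 : DD b1 w x = DD s1 (DD et F) (0, x) := by rw [hwdef, DD_slice (DD_contDiff _ hF)]
    rw [← e1, ← e2, hN0, P1x] at this
    linarith
  have t2 : (⟪DD et N (0, x), DD b2 f x⟫ : ℝ) = - p2 := by
    have := DD_inner_const et hN (DD_contDiff s2 hF) hN2 (0, x)
    rw [DD_comm et s2 hF] at this
    have e1 : DD b2 f x = DD s2 F (0, x) := by rw [← hFf, DD_slice hF]
    have e2 : DD b2 w x = DD s2 (DD et F) (0, x) := by rw [hwdef, DD_slice (DD_contDiff _ hF)]
    rw [← e1, ← e2, hN0, P2x] at this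
    linarith
  have t3 : (⟪DD et N (0, x), n x⟫ : ℝ) = 0 := by
    have := DD_inner_const et hN hN hNN (0, x)
    rw [real_inner_comm (DD et N (0, x)) (N (0, x)), hN0] at this
    linarith
  have DP : ∀ (e : RR2) {u a b : RR2 → ℝ}, ContDiff ℝ ∞ u → ContDiff ℝ ∞ a → ContDiff ℝ ∞ b →
      DD e (fun y => u y + σ₁ y * a y + σ₂ y * b y) x
        = DD e u x + (DD e σ₁ x * a x + σ₁ x * DD e a x) + (DD e σ₂ x * b x + σ₂ x * DD e b x) := by
    intro e u a b hu ha hb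
    rw [DD_add e (by fun_prop) (by fun_prop), DD_add e (by fun_prop) (by fun_prop),
      DD_mul e (by fun_prop) (by fun_prop), DD_mul e (by fun_prop) (by fun_prop)]
  refine ⟨?_, ?_, ?_, ?_, ?_, ?_⟩
  · rw [Dt_gm hF, hFf, k11]; ring
  · rw [Dt_gm hF, hFf, k22]; ring
  · rw [Dt_gm hF, hFf, k12, k21]
  · rw [Dt_Lm hF hN, hFf, hN0, h.n_ww hws b1 b1 x _ P1, DP _ (by fun_prop) (by fun_prop) (by fun_prop),
      h.pv x (DD et N (0, x)), h.pv x (DD b1 n x)]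
    simp only [t0, t1, t2, t3, h.ff_ee, h.g11, h.c11, h.c112, h.nf_e1, h.n_e, h.n1_e, h.n2_e, k11, k12,
      l11, l12, ← hE, ← hl1, ← hl2, ← hL11, ← hL12]
    field_simp
    ring
  · rw [Dt_Lm hF hN, hFf, hN0, h.n_ww hws b1 b2 x _ P1, DP _ (by fun_prop) (by fun_prop) (by fun_prop),
      h.pv x (DD et N (0, x)), h.pv x (DD b2 n x)]
    simp only [t0, t1, t2, t3, h.ff_ee, h.g12, h.sw, c121, h.c22, h.nf_e2, h.n_e, h.n1_e, h.n2_e, k11, k12,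
      l22, l12, ← hE, ← hl1, ← hl2, ← hL11, ← hL12]
    field_simp
    ring
  · rw [Dt_Lm hF hN, hFf, hN0, h.n_ww hws b2 b2 x _ P2, DP _ (by fun_prop) (by fun_prop) (by fun_prop),
      h.pv x (DD et N (0, x)), h.pv x (DD b2 n x)]
    simp only [t0, t1, t2, t3, h.ff_ee, h.g22, h.sw, h.c221, h.c22, h.nf_e2, h.n_e, h.n1_e, h.n2_e,
      k21, k22, l22, l12, ← hE, ← hl1, ← hl2, ← hL22, ← hL12]
    field_simp
    ring

end SV

namespace SV

open Set Filter Topology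
open scoped ContDiff

lemma abs_H {a b c l11 l12 l22 h : ℝ → ℝ} {a' b' c' l11' l12' l22' h' : ℝ}
    (ha : HasDerivAt a a' 0) (hb : HasDerivAt b b' 0) (hc : HasDerivAt c c' 0)
    (h11 : HasDerivAt l11 l11' 0) (h12 : HasDerivAt l12 l12' 0) (h22 : HasDerivAt l22 l22' 0)
    (hh : HasDerivAt h h' 0)
    (heq : ∀ t, 2 * (a t * c t - b t * b t) * h t = c t * l11 t - 2 * b t * l12 t + a t * l22 t) :
    2 * (a' * c 0 + a 0 * c' - 2 * b 0 * b') * h 0 + 2 * (a 0 * c 0 - b 0 * b 0) * h'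
      = c' * l11 0 + c 0 * l11' - 2 * b' * l12 0 - 2 * b 0 * l12' + a' * l22 0 + a 0 * l22' := by
  have A := ((((ha.mul hc).sub (hb.mul hb)).const_mul 2).mul hh)
  have B := ((hc.mul h11).sub ((hb.const_mul 2).mul h12)).add (ha.mul h22)
  have := A.unique (B.congr_of_eventuallyEq (Eventually.of_forall fun t => by
    simpa using heq t))
  simp only [Pi.mul_apply, Pi.sub_apply] at this
  linear_combination this

lemma abs_K (Q₁ Q₂ : ℝ) {a b c l11 l12 l22 h k : ℝ → ℝ} {a' b' c' l11' l12' l22' h' k' E : ℝ}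
    (ha : HasDerivAt a a' 0) (hb : HasDerivAt b b' 0) (hc : HasDerivAt c c' 0)
    (h11 : HasDerivAt l11 l11' 0) (h12 : HasDerivAt l12 l12' 0) (h22 : HasDerivAt l22 l22' 0)
    (hh : HasDerivAt h h' 0) (hk : HasDerivAt k k' 0)
    (ha0 : a 0 = E) (hb0 : b 0 = 0) (hc0 : c 0 = E)
    (heq : ∀ t, (a t * c t - b t * b t) * ((a t * c t - b t * b t) * k t) =
      (2 * Q₁ * (c t * c t) + 4 * Q₂ * (c t * b t) - 2 * Q₁ * (b t * b t)) * (l11 t - h t * a t)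
      + 2 * ((- b t) * (2 * Q₁ * c t + 2 * Q₂ * b t)
        + a t * (-2 * Q₂ * c t + 2 * Q₁ * b t)) * (l12 t - h t * b t)
      + (2 * Q₁ * (b t * b t) + 4 * Q₂ * (a t * b t) - 2 * Q₁ * (a t * a t))
        * (l22 t - h t * c t)) :
    2 * E ^ 2 * (E * (a' + c')) * k 0 + E ^ 4 * k' =
      (4 * Q₁ * E * c' + 4 * Q₂ * E * b') * (l11 0 - h 0 * E)
      - 4 * Q₂ * E * (a' + c') * l12 0 + (4 * Q₂ * E * b' - 4 * Q₁ * E * a') * (l22 0 - h 0 * E)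
      + 2 * Q₁ * E ^ 2 * (l11' - h' * E - h 0 * a') - 4 * Q₂ * E ^ 2 * (l12' - h 0 * b')
      - 2 * Q₁ * E ^ 2 * (l22' - h' * E - h 0 * c') := by
  have G := (ha.mul hc).sub (hb.mul hb)
  have A := G.mul (G.mul hk)
  have B1 := ((((hc.mul hc).const_mul (2 * Q₁)).add ((hc.mul hb).const_mul (4 * Q₂))).sub
    ((hb.mul hb).const_mul (2 * Q₁))).mul (h11.sub (hh.mul ha))
  have B2 := (((hb.neg.mul ((hc.const_mul (2 * Q₁)).add (hb.const_mul (2 * Q₂)))).add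
    (ha.mul ((hc.const_mul (-2 * Q₂)).add (hb.const_mul (2 * Q₁))))).const_mul 2).mul
      (h12.sub (hh.mul hb))
  have B3 := ((((hb.mul hb).const_mul (2 * Q₁)).add ((ha.mul hb).const_mul (4 * Q₂))).sub
    ((ha.mul ha).const_mul (2 * Q₁))).mul (h22.sub (hh.mul hc))
  have := A.unique (((B1.add B2).add B3).congr_of_eventuallyEq (Eventually.of_forall fun t => by
    simpa using heq t))
  simp only [Pi.mul_apply, Pi.sub_apply, Pi.add_apply, Pi.neg_apply, ha0, hb0, hc0] at this
  linear_combination this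

/-- time derivatives of `H` and `K` at a conformal time -/
lemma Dt_HK (Q₁ Q₂ : ℝ) {F N : ℝ × RR2 → RR4} (hF : ContDiff ℝ ∞ F) (hN : ContDiff ℝ ∞ N)
    (hG : ∀ p, 0 < GG s1 s2 F p) (x : RR2) {E : ℝ}
    (h11 : gm s1 s1 F (0, x) = E) (h22 : gm s2 s2 F (0, x) = E) (h12 : gm s1 s2 F (0, x) = 0) :
    (2 * (E * (DD et (gm s1 s1 F) (0, x) + DD et (gm s2 s2 F) (0, x))) * HH s1 s2 F N (0, x)
      + 2 * E ^ 2 * DD et (HH s1 s2 F N) (0, x)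
      = DD et (gm s2 s2 F) (0, x) * Lm s1 s1 F N (0, x) + E * DD et (Lm s1 s1 F N) (0, x)
      - 2 * DD et (gm s1 s2 F) (0, x) * Lm s1 s2 F N (0, x)
      + DD et (gm s1 s1 F) (0, x) * Lm s2 s2 F N (0, x) + E * DD et (Lm s2 s2 F N) (0, x)) ∧
    (2 * E ^ 2 * (E * (DD et (gm s1 s1 F) (0, x) + DD et (gm s2 s2 F) (0, x)))
        * KK Q₁ Q₂ s1 s2 F N (0, x) + E ^ 4 * DD et (KK Q₁ Q₂ s1 s2 F N) (0, x) =
      (4 * Q₁ * E * DD et (gm s2 s2 F) (0, x) + 4 * Q₂ * E * DD et (gm s1 s2 F) (0, x))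
        * (Lm s1 s1 F N (0, x) - HH s1 s2 F N (0, x) * E)
      - 4 * Q₂ * E * (DD et (gm s1 s1 F) (0, x) + DD et (gm s2 s2 F) (0, x)) * Lm s1 s2 F N (0, x)
      + (4 * Q₂ * E * DD et (gm s1 s2 F) (0, x) - 4 * Q₁ * E * DD et (gm s1 s1 F) (0, x))
        * (Lm s2 s2 F N (0, x) - HH s1 s2 F N (0, x) * E)
      + 2 * Q₁ * E ^ 2 * (DD et (Lm s1 s1 F N) (0, x) - DD et (HH s1 s2 F N) (0, x) * E
        - HH s1 s2 F N (0, x) * DD et (gm s1 s1 F) (0, x))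
      - 4 * Q₂ * E ^ 2 * (DD et (Lm s1 s2 F N) (0, x)
        - HH s1 s2 F N (0, x) * DD et (gm s1 s2 F) (0, x))
      - 2 * Q₁ * E ^ 2 * (DD et (Lm s2 s2 F N) (0, x) - DD et (HH s1 s2 F N) (0, x) * E
        - HH s1 s2 F N (0, x) * DD et (gm s2 s2 F) (0, x))) := by
  have ha := hasDerivAt_slice (gm_smooth s1 s1 hF) 0 x
  have hb := hasDerivAt_slice (gm_smooth s1 s2 hF) 0 x
  have hc := hasDerivAt_slice (gm_smooth s2 s2 hF) 0 x
  have hl11 := hasDerivAt_slice (Lm_smooth s1 s1 hF hN) 0 x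
  have hl12 := hasDerivAt_slice (Lm_smooth s1 s2 hF hN) 0 x
  have hl22 := hasDerivAt_slice (Lm_smooth s2 s2 hF hN) 0 x
  have hh := hasDerivAt_slice (HH_smooth hF hN hG) 0 x
  have hk := hasDerivAt_slice (KK_smooth Q₁ Q₂ hF hN hG) 0 x
  constructor
  · have := abs_H ha hb hc hl11 hl12 hl22 hh (by
      intro t
      have hg := (hG (t, x)).ne'
      unfold HH
      have : gm s1 s1 F (t, x) * gm s2 s2 F (t, x) - gm s1 s2 F (t, x) * gm s1 s2 F (t, x)
        = GG s1 s2 F (t, x) := by unfold GG; ring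
      rw [this, mul_div_cancel₀]; positivity)
    simp only [h11, h22, h12] at this
    linear_combination this
  · refine abs_K Q₁ Q₂ ha hb hc hl11 hl12 hl22 hh hk h11 h12 h22 ?_
    intro t
    have hg := (hG (t, x)).ne'
    have : gm s1 s1 F (t, x) * gm s2 s2 F (t, x) - gm s1 s2 F (t, x) * gm s1 s2 F (t, x)
        = GG s1 s2 F (t, x) := by unfold GG; ring
    rw [this]
    have : GG s1 s2 F (t, x) * (GG s1 s2 F (t, x) * KK Q₁ Q₂ s1 s2 F N (t, x))
        = KN Q₁ Q₂ s1 s2 F N (t, x) := by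
      unfold KK; field_simp
    rw [this]
    unfold KN
    ring

/-- purely algebraic part: the time derivative of `H` -/
lemma alg_H {E h H' v v11 v22 x1 x2 h1 h2 l1 l2 a b σ11 σ12 σ21 σ22 L11 L22 m11 m12 m21 m22
    L11_1 L12_1 L12_2 L22_2 DL11 DL22 p1 p2 : ℝ}
    (hL11 : L11 = E * h + a) (hL22 : L22 = E * h - a)
    (hm11 : m11 = E * σ11 + E * (l1 * x1 + l2 * x2) - v * L11)
    (hm12 : m12 = E * σ12 + E * (l1 * x2 - l2 * x1) - v * b)
    (hm21 : m21 = E * σ21 + E * (l2 * x1 - l1 * x2) - v * b)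
    (hm22 : m22 = E * σ22 + E * (l1 * x1 + l2 * x2) - v * L22)
    (c1 : L11_1 + L12_2 = 2 * l1 * E * h + 2 * E * h1)
    (c2 : L12_1 + L22_2 = 2 * l2 * E * h + 2 * E * h2)
    (e11 : E * DL11 = v * E ^ 2 - E * (l1 * p1 - l2 * p2)
      + E * (v11 + σ11 * L11 + σ12 * b + x1 * L11_1 + x2 * L12_1) + L11 * m11 + b * m12)
    (e22 : E * DL22 = v * E ^ 2 - E * (- l1 * p1 + l2 * p2)
      + E * (v22 + σ21 * b + σ22 * L22 + x1 * L12_2 + x2 * L22_2) + b * m21 + L22 * m22)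
    (eq : 2 * (E * (2 * m11 + 2 * m22)) * h + 2 * E ^ 2 * H'
      = 2 * m22 * L11 + E * DL11 - 2 * (m12 + m21) * b + 2 * m11 * L22 + E * DL22) :
    2 * E ^ 2 * H' = E * (v11 + v22) + (L11 ^ 2 + 2 * b ^ 2 + L22 ^ 2 + 2 * E ^ 2) * v
      + 2 * E ^ 2 * (x1 * h1 + x2 * h2) := by
  subst hm11 hm12 hm21 hm22 hL11 hL22
  linear_combination eq + e11 + e22 + E * x1 * c1 + E * x2 * c2

/-- purely algebraic part: the time derivative of `K` -/
lemma alg_K {E h S H' K' v v1 v2 v11 v12 v22 x1 x2 h1 h2 l1 l2 a a1 a2 b c1 c2 σ11 σ12 σ21 σ22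
    L11 L22 m11 m12 m21 m22
    L11_1 L11_2 L22_2 DL11 DL12 DL22 p1 p2 Q₁ Q₂ : ℝ} (hE : E ≠ 0)
    (hL11 : L11 = E * h + a) (hL22 : L22 = E * h - a)
    (hm11 : m11 = E * σ11 + E * (l1 * x1 + l2 * x2) - v * L11)
    (hm12 : m12 = E * σ12 + E * (l1 * x2 - l2 * x1) - v * b)
    (hm21 : m21 = E * σ21 + E * (l2 * x1 - l1 * x2) - v * b)
    (hm22 : m22 = E * σ22 + E * (l1 * x1 + l2 * x2) - v * L22)
    (hp1 : p1 = v1 + x1 * L11 + x2 * b) (hp2 : p2 = v2 + x1 * b + x2 * L22)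
    (hc1 : c1 = E * h2 + a2) (hc2 : c2 = E * h1 - a1)
    (hL111 : L11_1 = 2 * l1 * E * h + E * h1 + a1) (hL112 : L11_2 = 2 * l2 * E * h + E * h2 + a2)
    (hL222 : L22_2 = 2 * l2 * E * h + E * h2 - a2)
    (q0 : E ^ 2 * h = 4 * (Q₁ * a - Q₂ * b))
    (q1 : 4 * l1 * E ^ 2 * h + E ^ 2 * h1 = 4 * (Q₁ * a1 - Q₂ * c1))
    (q2 : 4 * l2 * E ^ 2 * h + E ^ 2 * h2 = 4 * (Q₁ * a2 - Q₂ * c2))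
    (qS : E ^ 2 * S = -4 * (Q₁ * b + Q₂ * a))
    (e11 : E * DL11 = v * E ^ 2 - E * (l1 * p1 - l2 * p2)
      + E * (v11 + σ11 * L11 + σ12 * b + x1 * L11_1 + x2 * c1) + L11 * m11 + b * m12)
    (e12 : E * DL12 = - E * (l2 * p1 + l1 * p2)
      + E * (v12 + σ21 * L11 + σ22 * b + x1 * L11_2 + x2 * c2) + b * m11 + L22 * m12)
    (e22 : E * DL22 = v * E ^ 2 - E * (- l1 * p1 + l2 * p2)
      + E * (v22 + σ21 * b + σ22 * L22 + x1 * c2 + x2 * L22_2) + b * m21 + L22 * m22)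
    (eq : 2 * E ^ 2 * (E * (2 * m11 + 2 * m22)) * h + E ^ 4 * K' =
      (4 * Q₁ * E * (2 * m22) + 4 * Q₂ * E * (m12 + m21)) * (L11 - h * E)
      - 4 * Q₂ * E * (2 * m11 + 2 * m22) * b
      + (4 * Q₂ * E * (m12 + m21) - 4 * Q₁ * E * (2 * m11)) * (L22 - h * E)
      + 2 * Q₁ * E ^ 2 * (DL11 - H' * E - h * (2 * m11)) - 4 * Q₂ * E ^ 2 * (DL12 - h * (m12 + m21))
      - 2 * Q₁ * E ^ 2 * (DL22 - H' * E - h * (2 * m22))) :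
    E ^ 2 * K' = 4 * h ^ 2 * v * E ^ 2 + 2 * Q₁ * (v11 - v22 - 2 * l1 * v1 + 2 * l2 * v2)
      - 2 * Q₂ * (2 * v12 - 2 * l1 * v2 - 2 * l2 * v1)
      - E ^ 2 * (h * (σ11 + σ22) + S * (σ12 - σ21)) + E ^ 2 * (x1 * h1 + x2 * h2) := by
  have k1 : E ^ 2 * (E ^ 2 * K') = E ^ 2 * (- 2 * E * h * (m11 + m22)
      + 2 * Q₁ * (DL11 - DL22 - 2 * h * (m11 - m22)) - 4 * Q₂ * (DL12 - h * (m12 + m21))) := by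
    rw [hL11, hL22] at eq
    linear_combination eq - 2 * E * (m11 + m22) * q0
  have k2 := mul_left_cancel₀ (pow_ne_zero 2 hE) k1
  apply mul_left_cancel₀ hE
  rw [k2]
  subst hm11 hm12 hm21 hm22 hp1 hp2 hL11 hL22 hL111 hL112 hL222 hc1 hc2
  linear_combination 2 * Q₁ * e11 - 2 * Q₁ * e22 - 4 * Q₂ * e12 - E * (σ11 + σ22) * q0
    - E * x1 * q1 - E * x2 * q2 + E * (σ12 - σ21) * qS

end SV

namespace SV

open Set Filter Topology
open scoped ContDiff

lemma alg_Y {E Ei h S H' K' v v1 v2 v11 v12 v22 x1 x2 h1 h2 S1 S2 l1 l2 a1 a2 c1 c2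
    σ11 σ12 σ21 σ22 Q₁ Q₂ M : ℝ} (hE : E ≠ 0) (z : E * Ei = 1)
    (hc1 : c1 = E * h2 + a2) (hc2 : c2 = E * h1 - a1)
    (q1 : 4 * l1 * E ^ 2 * h + E ^ 2 * h1 = 4 * (Q₁ * a1 - Q₂ * c1))
    (q2 : 4 * l2 * E ^ 2 * h + E ^ 2 * h2 = 4 * (Q₁ * a2 - Q₂ * c2))
    (qS1 : 4 * l1 * E ^ 2 * S + E ^ 2 * S1 = -4 * (Q₁ * c1 + Q₂ * a1))
    (qS2 : 4 * l2 * E ^ 2 * S + E ^ 2 * S2 = -4 * (Q₁ * c2 + Q₂ * a2))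
    (hH : 2 * E ^ 2 * H' = E * (v11 + v22) + (M + 2 * E ^ 2) * v
      + 2 * E ^ 2 * (x1 * h1 + x2 * h2))
    (hK : E ^ 2 * K' = 4 * h ^ 2 * v * E ^ 2 + 2 * Q₁ * (v11 - v22 - 2 * l1 * v1 + 2 * l2 * v2)
      - 2 * Q₂ * (2 * v12 - 2 * l1 * v2 - 2 * l2 * v1)
      - E ^ 2 * (h * (σ11 + σ22) + S * (σ12 - σ21)) + E ^ 2 * (x1 * h1 + x2 * h2)) :
    -2 * E * v * (H' - K') =
      E * (Ei * (v1 ^ 2 + v2 ^ 2) - 4 * Ei ^ 2 * (Q₁ * (v1 ^ 2 - v2 ^ 2) - 2 * Q₂ * v1 * v2)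
        - (Ei ^ 2 * M + 2 - 8 * h ^ 2) * v ^ 2)
      + E * (2 * h * (x1 * v1 + x2 * v2) + v * (x1 * h1 + x2 * h2)
        + 4 * v * Ei * (Q₁ * (x1 * h1 - x2 * h2) - Q₂ * (x1 * h2 + x2 * h1))
        + S * (x2 * v1 - x1 * v2))
      - S * v * ((2 * l1 * E * x2 + E * σ12) - (2 * l2 * E * x1 + E * σ21))
      + (-(v1 * v1 + v * v11)
        + 4 * (-2 * l1 * Ei * v * (Q₁ * v1 - Q₂ * v2) + Ei * v1 * (Q₁ * v1 - Q₂ * v2)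
          + Ei * v * (Q₁ * v11 - Q₂ * v12))
        - 2 * (2 * l1 * E * v * h * x1 + E * v1 * h * x1 + E * v * h1 * x1 + E * v * h * σ11)
        - (2 * l1 * E * v * S * x2 + E * v1 * S * x2 + E * v * S1 * x2 + E * v * S * σ12))
      + (-(v2 * v2 + v * v22)
        + 4 * (-2 * l2 * Ei * v * (-Q₁ * v2 - Q₂ * v1) + Ei * v2 * (-Q₁ * v2 - Q₂ * v1)
          + Ei * v * (-Q₁ * v22 - Q₂ * v12))
        - 2 * (2 * l2 * E * v * h * x2 + E * v2 * h * x2 + E * v * h2 * x2 + E * v * h * σ22)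
        + (2 * l2 * E * v * S * x1 + E * v2 * S * x1 + E * v * S2 * x1 + E * v * S * σ21)) := by
  apply mul_left_cancel₀ hE
  subst hc1 hc2
  linear_combination (-v) * hH + 2 * v * hK + v * x1 * (q1 - qS2) + v * x2 * (q2 + qS1)
    - z * (E * (v1 ^ 2 + v2 ^ 2) - (1 + E * Ei) * (4 * (Q₁ * (v1 ^ 2 - v2 ^ 2) - 2 * Q₂ * v1 * v2)
        + M * v ^ 2)
      + 4 * E * v * (Q₁ * (x1 * h1 - x2 * h2) - Q₂ * (x1 * h2 + x2 * h1))
      + 4 * (-2 * l1 * v * (Q₁ * v1 - Q₂ * v2) + v1 * (Q₁ * v1 - Q₂ * v2)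
          + v * (Q₁ * v11 - Q₂ * v12))
      + 4 * (-2 * l2 * v * (-Q₁ * v2 - Q₂ * v1) + v2 * (-Q₁ * v2 - Q₂ * v1)
          + v * (-Q₁ * v22 - Q₂ * v12)))

lemma DD_mul3 {V : Type*} [NormedAddCommGroup V] [NormedSpace ℝ V] (e : V) {a b c : V → ℝ}
    (ha : ContDiff ℝ ∞ a) (hb : ContDiff ℝ ∞ b) (hc : ContDiff ℝ ∞ c) (x : V) :
    DD e (fun y => a y * b y * c y) x
      = DD e a x * b x * c x + a x * DD e b x * c x + a x * b x * DD e c x := by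
  rw [DD_mul e (by fun_prop) hc, DD_mul e ha hb]; ring

lemma DD_mul4 {V : Type*} [NormedAddCommGroup V] [NormedSpace ℝ V] (e : V) {a b c d : V → ℝ}
    (ha : ContDiff ℝ ∞ a) (hb : ContDiff ℝ ∞ b) (hc : ContDiff ℝ ∞ c) (hd : ContDiff ℝ ∞ d) (x : V) :
    DD e (fun y => a y * b y * c y * d y) x
      = DD e a x * b x * c x * d x + a x * DD e b x * c x * d x + a x * b x * DD e c x * d x
        + a x * b x * c x * DD e d x := by
  rw [DD_mul e (by fun_prop) hd, DD_mul3 e ha hb hc]; ring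

lemma DD_Ei {lam : RR2 → ℝ} (hl : ContDiff ℝ ∞ lam) (e : RR2) (x : RR2) :
    DD e (fun y => Real.exp (-(2 * lam y))) x = -2 * DD e lam x * Real.exp (-(2 * lam x)) := by
  rw [DD_exp e (by fun_prop), DD_neg, DD_cmul e 2 hl]; ring

/-- first component of the divergence field -/
def Y1 (Q₁ Q₂ : ℝ) (lam σ₁ σ₂ v h S : RR2 → ℝ) (y : RR2) : ℝ :=
  -(v y * DD b1 v y)
    + 4 * (Real.exp (-(2 * lam y)) * v y * (Q₁ * DD b1 v y - Q₂ * DD b2 v y))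
    - 2 * (Real.exp (2 * lam y) * v y * h y * σ₁ y) - Real.exp (2 * lam y) * v y * S y * σ₂ y

/-- second component of the divergence field -/
def Y2 (Q₁ Q₂ : ℝ) (lam σ₁ σ₂ v h S : RR2 → ℝ) (y : RR2) : ℝ :=
  -(v y * DD b2 v y)
    + 4 * (Real.exp (-(2 * lam y)) * v y * (-Q₁ * DD b2 v y - Q₂ * DD b1 v y))
    - 2 * (Real.exp (2 * lam y) * v y * h y * σ₂ y) + Real.exp (2 * lam y) * v y * S y * σ₁ y

section

variable {lam σ₁ σ₂ v h S : RR2 → ℝ}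

lemma Y1_smooth (hl : ContDiff ℝ ∞ lam) (hσ₁ : ContDiff ℝ ∞ σ₁)
    (hσ₂ : ContDiff ℝ ∞ σ₂) (hv : ContDiff ℝ ∞ v) (hh : ContDiff ℝ ∞ h) (hS : ContDiff ℝ ∞ S)
    (Q₁ Q₂ : ℝ) : ContDiff ℝ ∞ (Y1 Q₁ Q₂ lam σ₁ σ₂ v h S) := by
  unfold Y1; fun_prop

lemma Y2_smooth (hl : ContDiff ℝ ∞ lam) (hσ₁ : ContDiff ℝ ∞ σ₁)
    (hσ₂ : ContDiff ℝ ∞ σ₂) (hv : ContDiff ℝ ∞ v) (hh : ContDiff ℝ ∞ h) (hS : ContDiff ℝ ∞ S)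
    (Q₁ Q₂ : ℝ) : ContDiff ℝ ∞ (Y2 Q₁ Q₂ lam σ₁ σ₂ v h S) := by
  unfold Y2; fun_prop

lemma DD_Y1 (hl : ContDiff ℝ ∞ lam) (hσ₁ : ContDiff ℝ ∞ σ₁)
    (hσ₂ : ContDiff ℝ ∞ σ₂) (hv : ContDiff ℝ ∞ v) (hh : ContDiff ℝ ∞ h) (hS : ContDiff ℝ ∞ S)
    (Q₁ Q₂ : ℝ) (e x : RR2) : DD e (Y1 Q₁ Q₂ lam σ₁ σ₂ v h S) x =
    -(DD e v x * DD b1 v x + v x * DD e (DD b1 v) x)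
    + 4 * (-2 * DD e lam x * Real.exp (-(2 * lam x)) * v x * (Q₁ * DD b1 v x - Q₂ * DD b2 v x)
      + Real.exp (-(2 * lam x)) * DD e v x * (Q₁ * DD b1 v x - Q₂ * DD b2 v x)
      + Real.exp (-(2 * lam x)) * v x * (Q₁ * DD e (DD b1 v) x - Q₂ * DD e (DD b2 v) x))
    - 2 * (2 * DD e lam x * Real.exp (2 * lam x) * v x * h x * σ₁ x
      + Real.exp (2 * lam x) * DD e v x * h x * σ₁ x + Real.exp (2 * lam x) * v x * DD e h x * σ₁ x
      + Real.exp (2 * lam x) * v x * h x * DD e σ₁ x)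
    - (2 * DD e lam x * Real.exp (2 * lam x) * v x * S x * σ₂ x
      + Real.exp (2 * lam x) * DD e v x * S x * σ₂ x + Real.exp (2 * lam x) * v x * DD e S x * σ₂ x
      + Real.exp (2 * lam x) * v x * S x * DD e σ₂ x) := by
  unfold Y1
  rw [DD_sub e (by fun_prop) (by fun_prop), DD_sub e (by fun_prop) (by fun_prop),
    DD_add e (by fun_prop) (by fun_prop), DD_neg, DD_mul e (by fun_prop) (by fun_prop),
    DD_cmul e 4 (by fun_prop), DD_mul3 e (by fun_prop) (by fun_prop) (by fun_prop),
    DD_sub e (by fun_prop) (by fun_prop), DD_cmul e Q₁ (by fun_prop), DD_cmul e Q₂ (by fun_prop),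
    DD_cmul e 2 (by fun_prop),
    DD_mul4 e (by fun_prop) (by fun_prop) (by fun_prop) (by fun_prop),
    DD_mul4 e (by fun_prop) (by fun_prop) (by fun_prop) (by fun_prop), DD_E hl, DD_Ei hl]

lemma DD_Y2 (hl : ContDiff ℝ ∞ lam) (hσ₁ : ContDiff ℝ ∞ σ₁)
    (hσ₂ : ContDiff ℝ ∞ σ₂) (hv : ContDiff ℝ ∞ v) (hh : ContDiff ℝ ∞ h) (hS : ContDiff ℝ ∞ S)
    (Q₁ Q₂ : ℝ) (e x : RR2) : DD e (Y2 Q₁ Q₂ lam σ₁ σ₂ v h S) x =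
    -(DD e v x * DD b2 v x + v x * DD e (DD b2 v) x)
    + 4 * (-2 * DD e lam x * Real.exp (-(2 * lam x)) * v x * (-Q₁ * DD b2 v x - Q₂ * DD b1 v x)
      + Real.exp (-(2 * lam x)) * DD e v x * (-Q₁ * DD b2 v x - Q₂ * DD b1 v x)
      + Real.exp (-(2 * lam x)) * v x * (-Q₁ * DD e (DD b2 v) x - Q₂ * DD e (DD b1 v) x))
    - 2 * (2 * DD e lam x * Real.exp (2 * lam x) * v x * h x * σ₂ x
      + Real.exp (2 * lam x) * DD e v x * h x * σ₂ x + Real.exp (2 * lam x) * v x * DD e h x * σ₂ x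
      + Real.exp (2 * lam x) * v x * h x * DD e σ₂ x)
    + (2 * DD e lam x * Real.exp (2 * lam x) * v x * S x * σ₁ x
      + Real.exp (2 * lam x) * DD e v x * S x * σ₁ x + Real.exp (2 * lam x) * v x * DD e S x * σ₁ x
      + Real.exp (2 * lam x) * v x * S x * DD e σ₁ x) := by
  unfold Y2
  rw [DD_add e (by fun_prop) (by fun_prop), DD_sub e (by fun_prop) (by fun_prop),
    DD_add e (by fun_prop) (by fun_prop), DD_neg, DD_mul e (by fun_prop) (by fun_prop),
    DD_cmul e 4 (by fun_prop), DD_mul3 e (by fun_prop) (by fun_prop) (by fun_prop),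
    DD_sub e (by fun_prop) (by fun_prop), DD_cmul e (-Q₁) (by fun_prop), DD_cmul e Q₂ (by fun_prop),
    DD_cmul e 2 (by fun_prop),
    DD_mul4 e (by fun_prop) (by fun_prop) (by fun_prop) (by fun_prop),
    DD_mul4 e (by fun_prop) (by fun_prop) (by fun_prop) (by fun_prop), DD_E hl, DD_Ei hl]

end

/-- the pointwise identity at time zero -/
lemma pointwise {f n : RR2 → RR4} {lam : RR2 → ℝ} (hcg : CG f n lam)
    {σ₁ σ₂ v h S : RR2 → ℝ} (hσ₁ : ContDiff ℝ ∞ σ₁) (hσ₂ : ContDiff ℝ ∞ σ₂) (hv : ContDiff ℝ ∞ v)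
    (hh : ContDiff ℝ ∞ h) (hS : ContDiff ℝ ∞ S) (Q₁ Q₂ : ℝ)
    (hEh : ∀ x, Real.exp (2 * lam x) * h x = (Lm b1 b1 f n x + Lm b2 b2 f n x) / 2)
    (hq : ∀ x, Real.exp (2 * lam x) * Real.exp (2 * lam x) * h x
      = 4 * (Q₁ * ((Lm b1 b1 f n x - Lm b2 b2 f n x) / 2) - Q₂ * Lm b1 b2 f n x))
    (hqS : ∀ x, Real.exp (2 * lam x) * Real.exp (2 * lam x) * S x
      = -4 * (Q₁ * Lm b1 b2 f n x + Q₂ * ((Lm b1 b1 f n x - Lm b2 b2 f n x) / 2)))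
    {F N : ℝ × RR2 → RR4} (hF : ContDiff ℝ ∞ F) (hN : ContDiff ℝ ∞ N)
    (hG : ∀ p, 0 < GG s1 s2 F p)
    (hNN : ∀ p, (⟪N p, N p⟫ : ℝ) = 1) (hNF : ∀ p, (⟪N p, F p⟫ : ℝ) = 0)
    (hN1 : ∀ p, (⟪N p, DD s1 F p⟫ : ℝ) = 0) (hN2 : ∀ p, (⟪N p, DD s2 F p⟫ : ℝ) = 0)
    (hF0 : ∀ x, F (0, x) = f x) (hN0 : ∀ x, N (0, x) = n x)
    (hw : ∀ x, DD et F (0, x) = σ₁ x • DD b1 f x + σ₂ x • DD b2 f x + v x • n x) (x : RR2) :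
    HH s1 s2 F N (0, x) = KK Q₁ Q₂ s1 s2 F N (0, x) ∧
    -2 * Real.exp (2 * lam x) * v x
        * (DD et (HH s1 s2 F N) (0, x) - DD et (KK Q₁ Q₂ s1 s2 F N) (0, x)) =
      Real.exp (2 * lam x) * (Real.exp (-(2 * lam x)) * (DD b1 v x ^ 2 + DD b2 v x ^ 2)
          - 4 * Real.exp (-(2 * lam x)) ^ 2 * (Q₁ * (DD b1 v x ^ 2 - DD b2 v x ^ 2)
            - 2 * Q₂ * DD b1 v x * DD b2 v x)
          - (Real.exp (-(2 * lam x)) ^ 2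
            * (Lm b1 b1 f n x ^ 2 + 2 * Lm b1 b2 f n x ^ 2 + Lm b2 b2 f n x ^ 2)
            + 2 - 8 * h x ^ 2) * v x ^ 2)
      + Real.exp (2 * lam x) * (2 * h x * (σ₁ x * DD b1 v x + σ₂ x * DD b2 v x)
        + v x * (σ₁ x * DD b1 h x + σ₂ x * DD b2 h x)
        + 4 * v x * Real.exp (-(2 * lam x)) * (Q₁ * (σ₁ x * DD b1 h x - σ₂ x * DD b2 h x)
          - Q₂ * (σ₁ x * DD b2 h x + σ₂ x * DD b1 h x))
        + S x * (σ₂ x * DD b1 v x - σ₁ x * DD b2 v x))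
      - S x * v x * (DD b1 (fun y => Real.exp (2 * lam y) * σ₂ y) x
        - DD b2 (fun y => Real.exp (2 * lam y) * σ₁ y) x)
      + DD b1 (Y1 Q₁ Q₂ lam σ₁ σ₂ v h S) x + DD b2 (Y2 Q₁ Q₂ lam σ₁ σ₂ v h S) x := by
  have hf := hcg.hf
  have hn := hcg.hn
  have hl := hcg.hl
  set E := Real.exp (2 * lam x) with hE
  have hE0 : E ≠ 0 := by rw [hE]; positivity
  have z : E * Real.exp (-(2 * lam x)) = 1 := by
    rw [hE, ← Real.exp_add, add_neg_cancel, Real.exp_zero]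
  have hFf : (fun y => F (0, y)) = f := funext hF0
  have hNn : (fun y => N (0, y)) = n := funext hN0
  have sg : ∀ a b : RR2, gm ((0 : ℝ), a) ((0 : ℝ), b) F (0, x) = gm a b f x := by
    intro a b; rw [← gm_slice 0 x hF, hFf]
  have sL : ∀ a b : RR2, Lm ((0 : ℝ), a) ((0 : ℝ), b) F N (0, x) = Lm a b f n x := by
    intro a b; rw [← Lm_slice 0 x hF, hFf, hNn]
  have g11 : gm s1 s1 F (0, x) = E := by rw [sg]; exact hcg.g11 x
  have g22 : gm s2 s2 F (0, x) = E := by rw [sg]; exact hcg.g22 x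
  have g12 : gm s1 s2 F (0, x) = 0 := by rw [sg]; exact hcg.g12 x
  have hEhx : E * h x = (Lm b1 b1 f n x + Lm b2 b2 f n x) / 2 := hEh x
  have hqx : E * E * h x
      = 4 * (Q₁ * ((Lm b1 b1 f n x - Lm b2 b2 f n x) / 2) - Q₂ * Lm b1 b2 f n x) := hq x
  have hHv : HH s1 s2 F N (0, x) = h x := by
    unfold HH GG
    rw [g11, g22, g12, sL, sL, sL, div_eq_iff (by simp [hE0])]
    linear_combination (-2) * E * hEhx
  have hKv : KK Q₁ Q₂ s1 s2 F N (0, x) = h x := by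
    unfold KK KN GG
    rw [hHv, g11, g22, g12, sL, sL, sL, div_eq_iff (by simp [hE0])]
    linear_combination (-E ^ 2) * hqx
  refine ⟨by rw [hHv, hKv], ?_⟩
  obtain ⟨V1, V2, V3, V4, V5, V6⟩ := variations hcg hσ₁ hσ₂ hv hF hN hNN hNF hN1 hN2 hF0 hN0 hw x
    hE rfl rfl rfl rfl rfl rfl rfl rfl rfl rfl rfl
  obtain ⟨T1, T2⟩ := Dt_HK Q₁ Q₂ hF hN hG x g11 g22 g12
  rw [V1, V2, V3, hHv, sL, sL, sL] at T1
  rw [V1, V2, V3, hHv, hKv, sL, sL, sL] at T2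
  -- derivative relations
  have dEh : ∀ e : RR2, 2 * DD e lam x * E * h x + E * DD e h x
      = (DD e (Lm b1 b1 f n) x + DD e (Lm b2 b2 f n) x) / 2 := by
    intro e
    have h1 : DD e (fun y => Real.exp (2 * lam y) * h y) x
        = DD e (fun y => (1 / 2) * (Lm b1 b1 f n y + Lm b2 b2 f n y)) x := by
      congr 1; funext y; rw [hEh]; ring
    rw [DD_mul e (by fun_prop) hh, DD_E hl, DD_cmul e _ (by fun_prop),
      DD_add e (by fun_prop) (by fun_prop)] at h1
    linear_combination h1
  have dq : ∀ e : RR2, 4 * DD e lam x * E ^ 2 * h x + E ^ 2 * DD e h x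
      = 4 * (Q₁ * ((DD e (Lm b1 b1 f n) x - DD e (Lm b2 b2 f n) x) / 2)
        - Q₂ * DD e (Lm b1 b2 f n) x) := by
    intro e
    have h1 : DD e (fun y => Real.exp (2 * lam y) * Real.exp (2 * lam y) * h y) x
        = DD e (fun y => (2 * Q₁) * (Lm b1 b1 f n y - Lm b2 b2 f n y)
          - (4 * Q₂) * Lm b1 b2 f n y) x := by
      congr 1; funext y; rw [hq]; ring
    rw [DD_mul3 e (by fun_prop) (by fun_prop) hh, DD_E hl, DD_sub e (by fun_prop) (by fun_prop),
      DD_cmul e _ (by fun_prop), DD_cmul e _ (by fun_prop),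
      DD_sub e (by fun_prop) (by fun_prop)] at h1
    linear_combination h1
  have dqS : ∀ e : RR2, 4 * DD e lam x * E ^ 2 * S x + E ^ 2 * DD e S x
      = -4 * (Q₁ * DD e (Lm b1 b2 f n) x
        + Q₂ * ((DD e (Lm b1 b1 f n) x - DD e (Lm b2 b2 f n) x) / 2)) := by
    intro e
    have h1 : DD e (fun y => Real.exp (2 * lam y) * Real.exp (2 * lam y) * S y) x
        = DD e (fun y => (-4 * Q₁) * Lm b1 b2 f n y
          + (-2 * Q₂) * (Lm b1 b1 f n y - Lm b2 b2 f n y)) x := by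
      congr 1; funext y; rw [hqS]; ring
    rw [DD_mul3 e (by fun_prop) (by fun_prop) hS, DD_E hl, DD_add e (by fun_prop) (by fun_prop),
      DD_cmul e _ (by fun_prop), DD_cmul e _ (by fun_prop),
      DD_sub e (by fun_prop) (by fun_prop)] at h1
    linear_combination h1
  have cz1 := hcg.codazzi1 x
  have cz2 := hcg.codazzi2 x
  have hL11 : Lm b1 b1 f n x = E * h x + (Lm b1 b1 f n x - Lm b2 b2 f n x) / 2 := by
    rw [hEhx]; ring
  have hL22 : Lm b2 b2 f n x = E * h x - (Lm b1 b1 f n x - Lm b2 b2 f n x) / 2 := by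
    rw [hEhx]; ring
  have hc1 : DD b1 (Lm b1 b2 f n) x = E * DD b2 h x
      + (DD b2 (Lm b1 b1 f n) x - DD b2 (Lm b2 b2 f n) x) / 2 := by
    linear_combination cz1 - dEh b2 + 2 * DD b2 lam x * hEhx
  have hc2 : DD b2 (Lm b1 b2 f n) x = E * DD b1 h x
      - (DD b1 (Lm b1 b1 f n) x - DD b1 (Lm b2 b2 f n) x) / 2 := by
    linear_combination (-1) * cz2 - dEh b1 + 2 * DD b1 lam x * hEhx
  have hH := alg_H (h1 := DD b1 h x) (h2 := DD b2 h x) hL11 hL22 rfl rfl rfl rfl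
    (by linear_combination hc2 - dEh b1) (by linear_combination hc1 - dEh b2) V4 V6 T1
  have hK := alg_K (h1 := DD b1 h x) (h2 := DD b2 h x) (S := S x)
    (a1 := (DD b1 (Lm b1 b1 f n) x - DD b1 (Lm b2 b2 f n) x) / 2)
    (a2 := (DD b2 (Lm b1 b1 f n) x - DD b2 (Lm b2 b2 f n) x) / 2) hE0 hL11 hL22 rfl rfl rfl rfl
    rfl rfl hc1 hc2 (by linear_combination (-1) * dEh b1) (by linear_combination (-1) * dEh b2)
    (by linear_combination (-1) * dEh b2) (by linear_combination hqx) (dq b1) (dq b2)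
    (by linear_combination hqS x) V4 V5 V6 T2
  have hY := alg_Y (S1 := DD b1 S x) (S2 := DD b2 S x) hE0 z hc1 hc2 (dq b1) (dq b2) (dqS b1) (dqS b2)
    hH hK
  rw [hY, DD_Y1 hl hσ₁ hσ₂ hv hh hS, DD_Y2 hl hσ₁ hσ₂ hv hh hS, DD_mul _ (by fun_prop) hσ₂,
    DD_mul _ (by fun_prop) hσ₁, DD_E hl, DD_E hl, DD_comm b2 b1 hv]

end SV

namespace SV

open Set Filter Topology
open scoped ContDiff

section shift

variable {V : Type*} [NormedAddCommGroup V] [NormedSpace ℝ V] {u : V}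

lemma sh_DD {F : Type*} [NormedAddCommGroup F] [NormedSpace ℝ F] {f : V → F}
    (hf : ∀ x, f (x + u) = f x) (e x : V) : DD e f (x + u) = DD e f x := by
  have : (fun y => f (y + u)) = f := funext hf
  unfold DD
  rw [← fderiv_comp_add_right, this]

lemma sh_gm {f : V → RR4} (hf : ∀ x, f (x + u) = f x) (a b x : V) :
    gm a b f (x + u) = gm a b f x := by
  unfold gm; simp only [sh_DD hf]

lemma sh_Lm {f n : V → RR4} (hf : ∀ x, f (x + u) = f x) (hn : ∀ x, n (x + u) = n x) (a b x : V) :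
    Lm a b f n (x + u) = Lm a b f n x := by
  unfold Lm; simp only [sh_DD (sh_DD hf a), hn]

lemma sh_XX1 {f : V → RR4} (hf : ∀ x, f (x + u) = f x) (a b c x : V) :
    XX1 a b c f (x + u) = XX1 a b c f x := by
  unfold XX1 PP1 FF GG; simp only [sh_gm hf]

lemma sh_XX2 {f : V → RR4} (hf : ∀ x, f (x + u) = f x) (a b c x : V) :
    XX2 a b c f (x + u) = XX2 a b c f x := by
  unfold XX2 PP2 FF GG; simp only [sh_gm hf]

end shift

lemma flux_zero {v₁ v₂ : RR2} (h : LinearIndependent ℝ ![v₁, v₂]) {X : ℝ × RR2 → ℝ}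
    (hX : ContDiff ℝ ∞ X) (h1 : ∀ p, X (p + ((0 : ℝ), v₁)) = X p)
    (h2 : ∀ p, X (p + ((0 : ℝ), v₂)) = X p) (e : RR2) :
    ∫ x in Par v₁ v₂, DD et (DD ((0 : ℝ), e) X) (0, x) = 0 := by
  have e1 : ∀ x, DD et (DD ((0 : ℝ), e) X) (0, x) = DD e (fun y => DD et X (0, y)) x := by
    intro x
    rw [DD_comm et _ hX, DD_slice (DD_contDiff _ hX)]
  simp only [e1]
  have hs : ContDiff ℝ ∞ (fun y : RR2 => DD et X (0, y)) :=
    (DD_contDiff et hX).comp (contDiff_const.prodMk contDiff_id)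
  refine int_v1 h hs (fun x => ⟨?_, ?_⟩) e
  · have := sh_DD h1 et (0, x); simpa using this
  · have := sh_DD h2 et (0, x); simpa using this

lemma sh_Y {u : RR2} {lam σ₁ σ₂ v h S : RR2 → ℝ} (hl : ∀ x, lam (x + u) = lam x)
    (h1 : ∀ x, σ₁ (x + u) = σ₁ x) (h2 : ∀ x, σ₂ (x + u) = σ₂ x) (hv : ∀ x, v (x + u) = v x)
    (hh : ∀ x, h (x + u) = h x) (hS : ∀ x, S (x + u) = S x) (Q₁ Q₂ : ℝ) (x : RR2) :
    Y1 Q₁ Q₂ lam σ₁ σ₂ v h S (x + u) = Y1 Q₁ Q₂ lam σ₁ σ₂ v h S x ∧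
    Y2 Q₁ Q₂ lam σ₁ σ₂ v h S (x + u) = Y2 Q₁ Q₂ lam σ₁ σ₂ v h S x := by
  unfold Y1 Y2
  simp only [hl, h1, h2, hv, hh, hS, sh_DD hv, and_self]

/-- periodicity of all derived data from that of `f` and `w` -/
lemma per_data {u : RR2} {f n w : RR2 → RR4} {lam : RR2 → ℝ} (hcg : CG f n lam)
    {σ₁ σ₂ v h S : RR2 → ℝ} (Q₁ Q₂ : ℝ)
    (hEh : ∀ x, Real.exp (2 * lam x) * h x = (Lm b1 b1 f n x + Lm b2 b2 f n x) / 2)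
    (hqS : ∀ x, Real.exp (2 * lam x) * Real.exp (2 * lam x) * S x
      = -4 * (Q₁ * Lm b1 b2 f n x + Q₂ * ((Lm b1 b1 f n x - Lm b2 b2 f n x) / 2)))
    (hw : ∀ x, w x = σ₁ x • DD b1 f x + σ₂ x • DD b2 f x + v x • n x)
    (pf : ∀ x, f (x + u) = f x) (pw : ∀ x, w (x + u) = w x) (x : RR2) :
    Y1 Q₁ Q₂ lam σ₁ σ₂ v h S (x + u) = Y1 Q₁ Q₂ lam σ₁ σ₂ v h S x ∧
    Y2 Q₁ Q₂ lam σ₁ σ₂ v h S (x + u) = Y2 Q₁ Q₂ lam σ₁ σ₂ v h S x := by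
  have pE : ∀ x, Real.exp (2 * lam (x + u)) = Real.exp (2 * lam x) := by
    intro x; rw [← hcg.g11, ← hcg.g11]; exact sh_gm pf b1 b1 x
  have pl : ∀ x, lam (x + u) = lam x := by
    intro x
    have := Real.exp_injective (pE x)
    linarith
  have nrm : ∀ x, ‖n x‖ = 1 := by
    intro x
    have := hcg.nn x
    rw [real_inner_self_eq_norm_sq] at this
    nlinarith [norm_nonneg (n x)]
  have ne := fun x => (normal_eq (nrm x) (hcg.nf x) (hcg.n1 x) (hcg.n2 x) (hcg.det x)).2
  have pn : ∀ x, n (x + u) = n x := by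
    intro x
    rw [ne (x + u), ne x, pf, sh_DD pf, sh_DD pf]
  have hE0 : ∀ x, Real.exp (2 * lam x) ≠ 0 := fun x => (Real.exp_pos _).ne'
  have ev : ∀ x, v x = ⟪n x, w x⟫ := by
    intro x
    rw [hw, inner_add_right, inner_add_right, real_inner_smul_right, real_inner_smul_right,
      real_inner_smul_right, hcg.n1, hcg.n2, hcg.nn]; ring
  have e1 : ∀ x, Real.exp (2 * lam x) * σ₁ x = ⟪DD b1 f x, w x⟫ := by
    intro x
    rw [hw, inner_add_right, inner_add_right, real_inner_smul_right, real_inner_smul_right,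
      real_inner_smul_right, real_inner_comm (n x), hcg.n1, hcg.g11, hcg.g12]; ring
  have e2 : ∀ x, Real.exp (2 * lam x) * σ₂ x = ⟪DD b2 f x, w x⟫ := by
    intro x
    rw [hw, inner_add_right, inner_add_right, real_inner_smul_right, real_inner_smul_right,
      real_inner_smul_right, real_inner_comm (n x), hcg.n2, hcg.g22,
      real_inner_comm (DD b1 f x), hcg.g12]; ring
  refine sh_Y pl ?_ ?_ ?_ ?_ ?_ Q₁ Q₂ x
  · intro x
    apply mul_left_cancel₀ (hE0 x)
    rw [e1 x, ← pE, e1, sh_DD pf, pw]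
  · intro x
    apply mul_left_cancel₀ (hE0 x)
    rw [e2 x, ← pE, e2, sh_DD pf, pw]
  · intro x
    rw [ev, ev, pn, pw]
  · intro x
    apply mul_left_cancel₀ (hE0 x)
    rw [hEh x, ← pE, hEh, sh_Lm pf pn, sh_Lm pf pn]
  · intro x
    apply mul_left_cancel₀ (mul_ne_zero (hE0 x) (hE0 x))
    rw [hqS x, ← pE, hqS, sh_Lm pf pn, sh_Lm pf pn, sh_Lm pf pn]

/-- the second variation formula, global form -/
theorem core {v₁ v₂ : RR2} (hlin : LinearIndependent ℝ ![v₁, v₂])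
    {f n : RR2 → RR4} {lam : RR2 → ℝ} (hcg : CG f n lam)
    {σ₁ σ₂ v h S : RR2 → ℝ} (hσ₁ : ContDiff ℝ ∞ σ₁) (hσ₂ : ContDiff ℝ ∞ σ₂) (hv : ContDiff ℝ ∞ v)
    (hh : ContDiff ℝ ∞ h) (hS : ContDiff ℝ ∞ S) (Q₁ Q₂ : ℝ)
    (hEh : ∀ x, Real.exp (2 * lam x) * h x = (Lm b1 b1 f n x + Lm b2 b2 f n x) / 2)
    (hq : ∀ x, Real.exp (2 * lam x) * Real.exp (2 * lam x) * h x
      = 4 * (Q₁ * ((Lm b1 b1 f n x - Lm b2 b2 f n x) / 2) - Q₂ * Lm b1 b2 f n x))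
    (hqS : ∀ x, Real.exp (2 * lam x) * Real.exp (2 * lam x) * S x
      = -4 * (Q₁ * Lm b1 b2 f n x + Q₂ * ((Lm b1 b1 f n x - Lm b2 b2 f n x) / 2)))
    {F N : ℝ × RR2 → RR4} (hF : ContDiff ℝ ∞ F) (hN : ContDiff ℝ ∞ N)
    (hG : ∀ p, 0 < GG s1 s2 F p) (hFF : ∀ p, (⟪F p, F p⟫ : ℝ) = 1)
    (hNN : ∀ p, (⟪N p, N p⟫ : ℝ) = 1) (hNF : ∀ p, (⟪N p, F p⟫ : ℝ) = 0)
    (hN1 : ∀ p, (⟪N p, DD s1 F p⟫ : ℝ) = 0) (hN2 : ∀ p, (⟪N p, DD s2 F p⟫ : ℝ) = 0)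
    (hdet : ∀ p, 0 < det4 (F p) (DD s1 F p) (DD s2 F p) (N p))
    (hp1 : ∀ p, F (p + ((0 : ℝ), v₁)) = F p) (hp2 : ∀ p, F (p + ((0 : ℝ), v₂)) = F p)
    (hF0 : ∀ x, F (0, x) = f x) (hN0 : ∀ x, N (0, x) = n x)
    (hw : ∀ x, DD et F (0, x) = σ₁ x • DD b1 f x + σ₂ x • DD b2 f x + v x • n x)
    (hcon : ∀ᶠ t in 𝓝 (0 : ℝ), ∫ x in Par v₁ v₂, KK Q₁ Q₂ s1 s2 F N (t, x)
      * ⟪N (t, x), DD et F (t, x)⟫ * FF s1 s2 F (t, x) = 0) :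
    deriv (deriv (fun t => ∫ x in Par v₁ v₂, FF s1 s2 F (t, x))) 0 =
      (∫ x in Par v₁ v₂,
        Real.exp (2 * lam x) * (Real.exp (-(2 * lam x)) * (DD b1 v x ^ 2 + DD b2 v x ^ 2)
          - 4 * Real.exp (-(2 * lam x)) ^ 2 * (Q₁ * (DD b1 v x ^ 2 - DD b2 v x ^ 2)
            - 2 * Q₂ * DD b1 v x * DD b2 v x)
          - (Real.exp (-(2 * lam x)) ^ 2
            * (Lm b1 b1 f n x ^ 2 + 2 * Lm b1 b2 f n x ^ 2 + Lm b2 b2 f n x ^ 2)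
            + 2 - 8 * h x ^ 2) * v x ^ 2))
      + (∫ x in Par v₁ v₂,
        Real.exp (2 * lam x) * (2 * h x * (σ₁ x * DD b1 v x + σ₂ x * DD b2 v x)
        + v x * (σ₁ x * DD b1 h x + σ₂ x * DD b2 h x)
        + 4 * v x * Real.exp (-(2 * lam x)) * (Q₁ * (σ₁ x * DD b1 h x - σ₂ x * DD b2 h x)
          - Q₂ * (σ₁ x * DD b2 h x + σ₂ x * DD b1 h x))
        + S x * (σ₂ x * DD b1 v x - σ₁ x * DD b2 v x)))
      - (∫ x in Par v₁ v₂,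
        S x * v x * (DD b1 (fun y => Real.exp (2 * lam y) * σ₂ y) x
        - DD b2 (fun y => Real.exp (2 * lam y) * σ₁ y) x)) := by
  have hf := hcg.hf
  have hn := hcg.hn
  have hl := hcg.hl
  have sFF : ContDiff ℝ ∞ (FF s1 s2 F) := FF_smooth hF hG
  have sHH : ContDiff ℝ ∞ (HH s1 s2 F N) := HH_smooth hF hN hG
  have sKK : ContDiff ℝ ∞ (KK Q₁ Q₂ s1 s2 F N) := KK_smooth Q₁ Q₂ hF hN hG
  have sX1 : ContDiff ℝ ∞ (XX1 et s1 s2 F) := XX1_smooth hF hG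
  have sX2 : ContDiff ℝ ∞ (XX2 et s1 s2 F) := XX2_smooth hF hG
  have sφ : ContDiff ℝ ∞ (fun p => (⟪N p, DD et F p⟫ : ℝ)) :=
    ContDiff.inner ℝ hN (DD_contDiff et hF)
  have slice : ∀ {g : ℝ × RR2 → ℝ}, ContDiff ℝ ∞ g → Continuous (fun x : RR2 => g (0, x)) :=
    fun hg => hg.continuous.comp (continuous_const.prodMk continuous_id)
  -- the first derivative
  have hA1 : deriv (fun t => ∫ x in Par v₁ v₂, FF s1 s2 F (t, x))
      = fun t => ∫ x in Par v₁ v₂, DD et (FF s1 s2 F) (t, x) :=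
    funext fun t => (Par_hasDerivAt hlin sFF t).deriv
  rw [hA1, (Par_hasDerivAt hlin (DD_contDiff et sFF) 0).deriv]
  -- the constraint
  have hC : ∫ x in Par v₁ v₂, DD et (fun p => KK Q₁ Q₂ s1 s2 F N p * ⟪N p, DD et F p⟫
      * FF s1 s2 F p) (0, x) = 0 := by
    have h1 := Par_hasDerivAt hlin ((sKK.mul sφ).mul sFF) 0
    have h2 : HasDerivAt (fun t : ℝ => ∫ x in Par v₁ v₂, KK Q₁ Q₂ s1 s2 F N (t, x)
      * ⟪N (t, x), DD et F (t, x)⟫ * FF s1 s2 F (t, x)) 0 0 :=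
      (hasDerivAt_const (0 : ℝ) (0 : ℝ)).congr_of_eventuallyEq hcon
    exact h1.unique h2
  have hfv : DD et (FF s1 s2 F) = fun p => (DD s1 (XX1 et s1 s2 F) p + DD s2 (XX2 et s1 s2 F) p)
      - 2 * (HH s1 s2 F N p * ⟪N p, DD et F p⟫ * FF s1 s2 F p) := by
    funext p
    rw [first_variation hF hG hFF hNN hNF hN1 hN2 hdet p]; ring
  have hdd : ∀ x, DD et (DD et (FF s1 s2 F)) (0, x) = DD et (DD s1 (XX1 et s1 s2 F)) (0, x)
      + DD et (DD s2 (XX2 et s1 s2 F)) (0, x)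
      - 2 * DD et (fun p => HH s1 s2 F N p * ⟪N p, DD et F p⟫ * FF s1 s2 F p) (0, x) := by
    intro x
    rw [hfv, DD_sub et (by fun_prop) (by fun_prop), DD_add et (by fun_prop) (by fun_prop),
      DD_cmul et 2 (by fun_prop)]
  have hv0 : ∀ x, (⟪N (0, x), DD et F (0, x)⟫ : ℝ) = v x := by
    intro x
    rw [hN0, hw, inner_add_right, inner_add_right, real_inner_smul_right, real_inner_smul_right,
      real_inner_smul_right, hcg.n1, hcg.n2, hcg.nn]; ring
  have hE0 : ∀ x, FF s1 s2 F (0, x) = Real.exp (2 * lam x) := by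
    intro x
    have hFf : (fun y => F (0, y)) = f := funext hF0
    unfold FF
    rw [← GG_slice 0 x hF, hFf]
    unfold GG
    rw [show gm b1 b1 f x = _ from hcg.g11 x, show gm b2 b2 f x = _ from hcg.g22 x,
      show gm b1 b2 f x = _ from hcg.g12 x]
    rw [show ∀ a : ℝ, a * a - 0 ^ 2 = a * a from fun a => by ring,
      Real.sqrt_mul_self (Real.exp_pos _).le]
  have pw := pointwise hcg hσ₁ hσ₂ hv hh hS Q₁ Q₂ hEh hq hqS hF hN hG hNN hNF hN1 hN2 hF0 hN0 hw
  have hdiff : ∀ x, -2 * DD et (fun p => HH s1 s2 F N p * ⟪N p, DD et F p⟫ * FF s1 s2 F p) (0, x)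
      = -2 * DD et (fun p => KK Q₁ Q₂ s1 s2 F N p * ⟪N p, DD et F p⟫ * FF s1 s2 F p) (0, x)
      + -2 * Real.exp (2 * lam x) * v x
        * (DD et (HH s1 s2 F N) (0, x) - DD et (KK Q₁ Q₂ s1 s2 F N) (0, x)) := by
    intro x
    rw [DD_mul3 et sHH sφ sFF, DD_mul3 et sKK sφ sFF, (pw x).1, hv0, hE0]; ring
  have sY1 := Y1_smooth hl hσ₁ hσ₂ hv hh hS Q₁ Q₂
  have sY2 := Y2_smooth hl hσ₁ hσ₂ hv hh hS Q₁ Q₂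
  have cL : ∀ a b : RR2, Continuous (Lm a b f n) := fun a b =>
    (show ContDiff ℝ ∞ (Lm a b f n) by fun_prop).continuous
  have cD : ∀ (e : RR2) {g : RR2 → ℝ}, ContDiff ℝ ∞ g → Continuous (DD e g) := fun e g hg =>
    (DD_contDiff e hg).continuous
  have cl := hl.continuous
  have cs1 := hσ₁.continuous
  have cs2 := hσ₂.continuous
  have cv := hv.continuous
  have ch := hh.continuous
  have cS := hS.continuous
  have cv1 := cD b1 hv
  have cv2 := cD b2 hv
  have ch1 := cD b1 hh
  have ch2 := cD b2 hh
  have c11 := cL b1 b1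
  have c12 := cL b1 b2
  have c22 := cL b2 b2
  have ce1 := cD b1 (show ContDiff ℝ ∞ (fun y => Real.exp (2 * lam y) * σ₂ y) by fun_prop)
  have ce2 := cD b2 (show ContDiff ℝ ∞ (fun y => Real.exp (2 * lam y) * σ₁ y) by fun_prop)
  have pf1 : ∀ x, f (x + v₁) = f x := by
    intro x; have := hp1 (0, x); rw [← hF0, ← hF0]; simpa using this
  have pf2 : ∀ x, f (x + v₂) = f x := by
    intro x; have := hp2 (0, x); rw [← hF0, ← hF0]; simpa using this
  have pw1 : ∀ x, DD et F (0, x + v₁) = DD et F (0, x) := by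
    intro x; have := sh_DD hp1 et (0, x); simpa using this
  have pw2 : ∀ x, DD et F (0, x + v₂) = DD et F (0, x) := by
    intro x; have := sh_DD hp2 et (0, x); simpa using this
  have d1 := fun x => per_data (w := fun x => DD et F (0, x)) hcg Q₁ Q₂ hEh hqS hw pf1 pw1 x
  have d2 := fun x => per_data (w := fun x => DD et F (0, x)) hcg Q₁ Q₂ hEh hqS hw pf2 pw2 x
  have iY1 : ∫ x in Par v₁ v₂, DD b1 (Y1 Q₁ Q₂ lam σ₁ σ₂ v h S) x = 0 :=
    int_v1 hlin sY1 (fun x => ⟨(d1 x).1, (d2 x).1⟩) b1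
  have iY2 : ∫ x in Par v₁ v₂, DD b2 (Y2 Q₁ Q₂ lam σ₁ σ₂ v h S) x = 0 :=
    int_v1 hlin sY2 (fun x => ⟨(d1 x).2, (d2 x).2⟩) b2
  have iX1 := flux_zero hlin sX1 (sh_XX1 hp1 et s1 s2) (sh_XX1 hp2 et s1 s2) b1
  have iX2 := flux_zero hlin sX2 (sh_XX2 hp1 et s1 s2) (sh_XX2 hp2 et s1 s2) b2
  have cX1 := slice (DD_contDiff et (DD_contDiff s1 sX1))
  have cX2 := slice (DD_contDiff et (DD_contDiff s2 sX2))
  have cK := slice (DD_contDiff et ((sKK.mul sφ).mul sFF))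
  have cY1 := cD b1 sY1
  have cY2 := cD b2 sY2
  have key : ∀ x, DD et (DD et (FF s1 s2 F)) (0, x) =
      (DD et (DD s1 (XX1 et s1 s2 F)) (0, x) + (DD et (DD s2 (XX2 et s1 s2 F)) (0, x)
      + (-2 * DD et (fun p => KK Q₁ Q₂ s1 s2 F N p * ⟪N p, DD et F p⟫ * FF s1 s2 F p) (0, x)
      + (DD b1 (Y1 Q₁ Q₂ lam σ₁ σ₂ v h S) x + (DD b2 (Y2 Q₁ Q₂ lam σ₁ σ₂ v h S) x
      + ((Real.exp (2 * lam x) * (Real.exp (-(2 * lam x)) * (DD b1 v x ^ 2 + DD b2 v x ^ 2)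
          - 4 * Real.exp (-(2 * lam x)) ^ 2 * (Q₁ * (DD b1 v x ^ 2 - DD b2 v x ^ 2)
            - 2 * Q₂ * DD b1 v x * DD b2 v x)
          - (Real.exp (-(2 * lam x)) ^ 2
            * (Lm b1 b1 f n x ^ 2 + 2 * Lm b1 b2 f n x ^ 2 + Lm b2 b2 f n x ^ 2)
            + 2 - 8 * h x ^ 2) * v x ^ 2)
      + Real.exp (2 * lam x) * (2 * h x * (σ₁ x * DD b1 v x + σ₂ x * DD b2 v x)
        + v x * (σ₁ x * DD b1 h x + σ₂ x * DD b2 h x)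
        + 4 * v x * Real.exp (-(2 * lam x)) * (Q₁ * (σ₁ x * DD b1 h x - σ₂ x * DD b2 h x)
          - Q₂ * (σ₁ x * DD b2 h x + σ₂ x * DD b1 h x))
        + S x * (σ₂ x * DD b1 v x - σ₁ x * DD b2 v x)))
      - S x * v x * (DD b1 (fun y => Real.exp (2 * lam y) * σ₂ y) x
        - DD b2 (fun y => Real.exp (2 * lam y) * σ₁ y) x))))))) := by
    intro x
    linear_combination hdd x + hdiff x + (pw x).2
  simp only [key]
  rw [integral_add (Par_integrable cX1) (Par_integrable (by fun_prop)),
    integral_add (Par_integrable cX2) (Par_integrable (by fun_prop)),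
    integral_add (Par_integrable (by fun_prop)) (Par_integrable (by fun_prop)),
    integral_add (Par_integrable cY1) (Par_integrable (by fun_prop)),
    integral_add (Par_integrable cY2) (Par_integrable (by fun_prop)),
    integral_sub (Par_integrable (by fun_prop)) (Par_integrable (by fun_prop)),
    integral_add (Par_integrable (by fun_prop)) (Par_integrable (by fun_prop)),
    integral_const_mul, hC, iX1, iX2, iY1, iY2]
  ring

end SV

namespace SV

open Set Filter Topology
open scoped ContDiff

lemma exists_chi : ∃ χ : ℝ → ℝ, ContDiff ℝ ∞ χ ∧ (∀ t, χ t ∈ Set.Ioo (-1 : ℝ) 1) ∧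
    ∀ t ∈ Set.Ioo (-(1 / 4) : ℝ) (1 / 4), χ t = t := by
  let b : ContDiffBump (0 : ℝ) := ⟨1 / 4, 1 / 2, by norm_num, by norm_num⟩
  refine ⟨fun t => t * b t, contDiff_id.mul b.contDiff, fun t => ?_, fun t ht => ?_⟩
  · rw [Set.mem_Ioo, ← abs_lt]
    rcases lt_or_ge |t| (1 / 2) with h | h
    · rw [abs_mul, abs_of_nonneg b.nonneg]
      have h1 : b t ≤ 1 := b.le_one
      have h0 : 0 ≤ b t := b.nonneg
      nlinarith [abs_nonneg t]
    · have : b t = 0 := b.zero_of_le_dist (by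
        rw [Real.dist_eq, sub_zero]; exact h)
      simp [this]
  · have : b t = 1 := b.one_of_mem_closedBall (by
      rw [Metric.mem_closedBall, Real.dist_eq, sub_zero]
      exact (abs_lt.2 ht).le)
    simp [this]

end SV

/-- **second variation of the area under the conformal constraint.**
For a smooth doubly periodic variation `Φ_t` through immersions of the torus into `S³`
whose slice `Φ₀` is conformal and satisfies the conformally constrained minimal surface
equation (a), and which satisfies the infinitesimal conformal-class constraint (b), the
second derivative of the area `A(t) = ∫_P √(det g_t)` at `t = 0` is given by the stated
quadratic expression in `v, σ₁, σ₂`. -/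
theorem second_variation_area_conformal_constraint
    (v₁ v₂ : RR2) (hv12 : LinearIndependent ℝ ![v₁, v₂])
    (P : Set RR2)
    (hP : P = (fun p : ℝ × ℝ => p.1 • v₁ + p.2 • v₂) '' (Set.Ico 0 1 ×ˢ Set.Ico 0 1))
    (Φ : ℝ × RR2 → RR4)
    (hΦ : ContDiffOn ℝ (⊤ : ℕ∞) Φ (Set.Ioo (-1 : ℝ) 1 ×ˢ (Set.univ : Set RR2)))
    (hsph : ∀ t ∈ Set.Ioo (-1 : ℝ) 1, ∀ x : RR2, ‖Φ (t, x)‖ = 1)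
    (hper : ∀ t ∈ Set.Ioo (-1 : ℝ) 1, ∀ (x : RR2) (m k : ℤ),
      Φ (t, x + m • v₁ + k • v₂) = Φ (t, x))
    (himm : ∀ t ∈ Set.Ioo (-1 : ℝ) 1, ∀ x : RR2,
      LinearIndependent ℝ ![d1 (fun y => Φ (t, y)) x, d2 (fun y => Φ (t, y)) x])
    (Φ₀ : RR2 → RR4) (hΦ₀ : ∀ x : RR2, Φ₀ x = Φ (0, x))
    (lam : RR2 → ℝ) (n : RR2 → RR4)
    (h0 : IsConformalImmersionS3 Set.univ Φ₀ lam n)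
    (N : ℝ → RR2 → RR4)
    (hN_norm : ∀ t ∈ Set.Ioo (-1 : ℝ) 1, ∀ x : RR2, ‖N t x‖ = 1)
    (hN_Phi : ∀ t ∈ Set.Ioo (-1 : ℝ) 1, ∀ x : RR2, ⟪N t x, Φ (t, x)⟫ = 0)
    (hN_d1 : ∀ t ∈ Set.Ioo (-1 : ℝ) 1, ∀ x : RR2, ⟪N t x, d1 (fun y => Φ (t, y)) x⟫ = 0)
    (hN_d2 : ∀ t ∈ Set.Ioo (-1 : ℝ) 1, ∀ x : RR2, ⟪N t x, d2 (fun y => Φ (t, y)) x⟫ = 0)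
    (hN_orient : ∀ t ∈ Set.Ioo (-1 : ℝ) 1, ∀ x : RR2,
      0 < det4 (Φ (t, x)) (d1 (fun y => Φ (t, y)) x) (d2 (fun y => Φ (t, y)) x) (N t x))
    (Q₁ Q₂ : ℝ)
    (hccms : ∀ x : RR2, meanCurv Φ₀ lam n x
      = 4 * exp (-(4 * lam x)) * (Q₁ * I011 Φ₀ n x - Q₂ * I012 Φ₀ n x))
    (hconstraint : ∀ t ∈ Set.Ioo (-1 : ℝ) 1,
      ∫ x in P, qPairing Q₁ Q₂ (fun y => Φ (t, y)) (N t) x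
          * ⟪N t x, deriv (fun s => Φ (s, x)) t⟫
          * Real.sqrt ((gmat (fun y => Φ (t, y)) x).det) = 0)
    (σ₁ σ₂ v : RR2 → ℝ)
    (hσ₁ : ContDiff ℝ (⊤ : ℕ∞) σ₁) (hσ₂ : ContDiff ℝ (⊤ : ℕ∞) σ₂)
    (hv : ContDiff ℝ (⊤ : ℕ∞) v)
    (hw : ∀ x : RR2, deriv (fun t => Φ (t, x)) 0
      = σ₁ x • d1 Φ₀ x + σ₂ x • d2 Φ₀ x + v x • n x)
    (S : RR2 → ℝ)
    (hS : ∀ x : RR2, S x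
      = -4 * exp (-(4 * lam x)) * (Q₁ * I012 Φ₀ n x + Q₂ * I011 Φ₀ n x)) :
    deriv (deriv (fun t => ∫ x in P,
        Real.sqrt ((gmat (fun y => Φ (t, y)) x).det))) 0
      = (∫ x in P, exp (2 * lam x)
            * (exp (-(2 * lam x)) * ((d1s v x) ^ 2 + (d2s v x) ^ 2)
              - 4 * exp (-(4 * lam x))
                  * (Q₁ * ((d1s v x) ^ 2 - (d2s v x) ^ 2)
                    - 2 * Q₂ * d1s v x * d2s v x)
              - (exp (-(4 * lam x))
                    * ((I11 Φ₀ n x) ^ 2 + 2 * (I12 Φ₀ n x) ^ 2 + (I22 Φ₀ n x) ^ 2)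
                  + 2 - 8 * (meanCurv Φ₀ lam n x) ^ 2) * (v x) ^ 2))
        + (∫ x in P, exp (2 * lam x)
            * (2 * meanCurv Φ₀ lam n x * (σ₁ x * d1s v x + σ₂ x * d2s v x)
              + v x * (σ₁ x * d1s (meanCurv Φ₀ lam n) x
                  + σ₂ x * d2s (meanCurv Φ₀ lam n) x)
              + 4 * v x * exp (-(2 * lam x))
                  * (Q₁ * (σ₁ x * d1s (meanCurv Φ₀ lam n) x
                        - σ₂ x * d2s (meanCurv Φ₀ lam n) x)
                    - Q₂ * (σ₁ x * d2s (meanCurv Φ₀ lam n) x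
                        + σ₂ x * d1s (meanCurv Φ₀ lam n) x))
              + S x * (σ₂ x * d1s v x - σ₁ x * d2s v x)))
        - ∫ x in P, S x * v x
            * (d1s (fun y => exp (2 * lam y) * σ₂ y) x
              - d2s (fun y => exp (2 * lam y) * σ₁ y) x) := by
  have hΦ₀' : (fun y => Φ (0, y)) = Φ₀ := funext fun y => (hΦ₀ y).symm
  have i0 : (0 : ℝ) ∈ Set.Ioo (-1 : ℝ) 1 := by norm_num
  -- conformal data in global form
  have hcg : SV.CG Φ₀ n lam := by
    have e2 : ∀ x, Real.exp (2 * lam x) = Real.exp (lam x) ^ 2 := by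
      intro x; rw [two_mul, Real.exp_add, sq]
    refine ⟨contDiffOn_univ.1 h0.smooth_Phi, contDiffOn_univ.1 h0.smooth_n,
      contDiffOn_univ.1 h0.smooth_lam, fun x => ?_, fun x => ?_, fun x => ?_,
      fun x => h0.conf_orth x (Set.mem_univ x), fun x => ?_,
      fun x => h0.n_orth_Phi x (Set.mem_univ x), fun x => h0.n_orth_d1 x (Set.mem_univ x),
      fun x => h0.n_orth_d2 x (Set.mem_univ x), fun x => h0.oriented x (Set.mem_univ x)⟩
    · rw [real_inner_self_eq_norm_sq, h0.mem_sphere x (Set.mem_univ x)]; norm_num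
    · rw [real_inner_self_eq_norm_sq, e2]
      exact congrArg (· ^ 2) (h0.conf_norm1 x (Set.mem_univ x))
    · rw [real_inner_self_eq_norm_sq, e2]
      exact congrArg (· ^ 2) (h0.conf_norm2 x (Set.mem_univ x))
    · rw [real_inner_self_eq_norm_sq, h0.n_norm x (Set.mem_univ x)]; norm_num
  have hf := hcg.hf
  have hn := hcg.hn
  have hl := hcg.hl
  have z : ∀ x, Real.exp (2 * lam x) * Real.exp (-(2 * lam x)) = 1 := by
    intro x; rw [← Real.exp_add, add_neg_cancel, Real.exp_zero]
  have z4 : ∀ x, Real.exp (-(4 * lam x)) = Real.exp (-(2 * lam x)) ^ 2 := by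
    intro x; rw [sq, ← Real.exp_add]; congr 1; ring
  have z44 : ∀ x, Real.exp (2 * lam x) * Real.exp (2 * lam x) * Real.exp (-(4 * lam x)) = 1 := by
    intro x; rw [z4]
    linear_combination (1 + Real.exp (2 * lam x) * Real.exp (-(2 * lam x))) * z x
  have hh : ContDiff ℝ (⊤ : ℕ∞) (meanCurv Φ₀ lam n) := by
    have : meanCurv Φ₀ lam n = fun x => (1 / 2) * Real.exp (-(2 * lam x))
        * (SV.Lm SV.b1 SV.b1 Φ₀ n x + SV.Lm SV.b2 SV.b2 Φ₀ n x) := rfl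
    rw [this]; fun_prop
  have hSs : ContDiff ℝ (⊤ : ℕ∞) S := by
    have : S = fun x => -4 * Real.exp (-(4 * lam x)) * (Q₁ * SV.Lm SV.b1 SV.b2 Φ₀ n x
        + Q₂ * ((SV.Lm SV.b1 SV.b1 Φ₀ n x - SV.Lm SV.b2 SV.b2 Φ₀ n x) / 2)) := funext hS
    rw [this]; fun_prop
  have hEh : ∀ x, Real.exp (2 * lam x) * meanCurv Φ₀ lam n x
      = (SV.Lm SV.b1 SV.b1 Φ₀ n x + SV.Lm SV.b2 SV.b2 Φ₀ n x) / 2 := by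
    intro x
    have : meanCurv Φ₀ lam n x = (1 / 2) * Real.exp (-(2 * lam x))
        * (SV.Lm SV.b1 SV.b1 Φ₀ n x + SV.Lm SV.b2 SV.b2 Φ₀ n x) := rfl
    rw [this]
    linear_combination ((SV.Lm SV.b1 SV.b1 Φ₀ n x + SV.Lm SV.b2 SV.b2 Φ₀ n x) / 2) * z x
  have hq : ∀ x, Real.exp (2 * lam x) * Real.exp (2 * lam x) * meanCurv Φ₀ lam n x
      = 4 * (Q₁ * ((SV.Lm SV.b1 SV.b1 Φ₀ n x - SV.Lm SV.b2 SV.b2 Φ₀ n x) / 2)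
        - Q₂ * SV.Lm SV.b1 SV.b2 Φ₀ n x) := by
    intro x
    have : meanCurv Φ₀ lam n x = 4 * Real.exp (-(4 * lam x))
        * (Q₁ * ((SV.Lm SV.b1 SV.b1 Φ₀ n x - SV.Lm SV.b2 SV.b2 Φ₀ n x) / 2)
          - Q₂ * SV.Lm SV.b1 SV.b2 Φ₀ n x) := hccms x
    rw [this]
    linear_combination (4 * (Q₁ * ((SV.Lm SV.b1 SV.b1 Φ₀ n x - SV.Lm SV.b2 SV.b2 Φ₀ n x) / 2)
        - Q₂ * SV.Lm SV.b1 SV.b2 Φ₀ n x)) * z44 x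
  have hqS : ∀ x, Real.exp (2 * lam x) * Real.exp (2 * lam x) * S x
      = -4 * (Q₁ * SV.Lm SV.b1 SV.b2 Φ₀ n x
        + Q₂ * ((SV.Lm SV.b1 SV.b1 Φ₀ n x - SV.Lm SV.b2 SV.b2 Φ₀ n x) / 2)) := by
    intro x
    have : S x = -4 * Real.exp (-(4 * lam x)) * (Q₁ * SV.Lm SV.b1 SV.b2 Φ₀ n x
        + Q₂ * ((SV.Lm SV.b1 SV.b1 Φ₀ n x - SV.Lm SV.b2 SV.b2 Φ₀ n x) / 2)) := hS x
    rw [this]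
    linear_combination (-4 * (Q₁ * SV.Lm SV.b1 SV.b2 Φ₀ n x
        + Q₂ * ((SV.Lm SV.b1 SV.b1 Φ₀ n x - SV.Lm SV.b2 SV.b2 Φ₀ n x) / 2))) * z44 x
  -- globalize in time
  obtain ⟨χ, hχ, hχm, hχe⟩ := SV.exists_chi
  have hχ0 : χ 0 = 0 := hχe 0 (by norm_num)
  let F : ℝ × RR2 → RR4 := fun p => Φ (χ p.1, p.2)
  let M : ℝ × RR2 → RR4 := fun p => N (χ p.1) p.2
  have hF : ContDiff ℝ (⊤ : ℕ∞) F := by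
    rw [← contDiffOn_univ]
    have h1 : ContDiff ℝ (⊤ : ℕ∞) (fun p : ℝ × RR2 => (χ p.1, p.2)) :=
      (hχ.comp contDiff_fst).prodMk contDiff_snd
    exact hΦ.comp h1.contDiffOn (fun p _ => ⟨hχm p.1, Set.mem_univ _⟩)
  have hFs1 : ∀ p, SV.DD SV.s1 F p = d1 (fun y => Φ (χ p.1, y)) p.2 := fun p =>
    (congrFun (SV.DD_slice hF p.1 SV.b1) p.2).symm
  have hFs2 : ∀ p, SV.DD SV.s2 F p = d2 (fun y => Φ (χ p.1, y)) p.2 := fun p =>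
    (congrFun (SV.DD_slice hF p.1 SV.b2) p.2).symm
  have hFF : ∀ p, (⟪F p, F p⟫ : ℝ) = 1 := by
    intro p; rw [real_inner_self_eq_norm_sq]
    rw [show ‖F p‖ = 1 from hsph _ (hχm p.1) p.2]; norm_num
  have hMn : ∀ p, ‖M p‖ = 1 := fun p => hN_norm _ (hχm p.1) p.2
  have hMM : ∀ p, (⟪M p, M p⟫ : ℝ) = 1 := by
    intro p; rw [real_inner_self_eq_norm_sq, hMn]; norm_num
  have hMF : ∀ p, (⟪M p, F p⟫ : ℝ) = 0 := fun p => hN_Phi _ (hχm p.1) p.2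
  have hM1 : ∀ p, (⟪M p, SV.DD SV.s1 F p⟫ : ℝ) = 0 := by
    intro p; rw [hFs1]; exact hN_d1 _ (hχm p.1) p.2
  have hM2 : ∀ p, (⟪M p, SV.DD SV.s2 F p⟫ : ℝ) = 0 := by
    intro p; rw [hFs2]; exact hN_d2 _ (hχm p.1) p.2
  have hdet : ∀ p, 0 < det4 (F p) (SV.DD SV.s1 F p) (SV.DD SV.s2 F p) (M p) := by
    intro p; rw [hFs1, hFs2]; exact hN_orient _ (hχm p.1) p.2
  have hM : ContDiff ℝ (⊤ : ℕ∞) M :=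
    SV.normal_smooth hF (SV.DD_contDiff _ hF) (SV.DD_contDiff _ hF) hMn hMF hM1 hM2 hdet
  have hFe : ∀ e p, (⟪F p, SV.DD e F p⟫ : ℝ) = 0 := by
    intro e p
    have := SV.DD_inner_const e hF hF hFF p
    rw [real_inner_comm] at this; linarith
  have hG : ∀ p, 0 < SV.GG SV.s1 SV.s2 F p := fun p =>
    SV.gram_pos (hdet p) (hFF p) (hFe _ p) (hFe _ p) (hMM p) (hMF p) (hM1 p) (hM2 p)
  have hp1 : ∀ p, F (p + ((0 : ℝ), v₁)) = F p := by
    intro p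
    have := hper _ (hχm p.1) p.2 1 0
    simpa [F] using this
  have hp2 : ∀ p, F (p + ((0 : ℝ), v₂)) = F p := by
    intro p
    have := hper _ (hχm p.1) p.2 0 1
    simpa [F] using this
  have hF0 : ∀ x, F (0, x) = Φ₀ x := by
    intro x; rw [hΦ₀]; simp only [F, hχ0]
  have hM0 : ∀ x, M (0, x) = n x := by
    intro x
    have a1 := (SV.normal_eq (hN_norm 0 i0 x) (hN_Phi 0 i0 x) (hN_d1 0 i0 x) (hN_d2 0 i0 x)
      (hN_orient 0 i0 x)).2
    have a2 := (SV.normal_eq (h0.n_norm x (Set.mem_univ x)) (h0.n_orth_Phi x (Set.mem_univ x))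
      (h0.n_orth_d1 x (Set.mem_univ x)) (h0.n_orth_d2 x (Set.mem_univ x))
      (h0.oriented x (Set.mem_univ x))).2
    rw [hΦ₀', ← hΦ₀] at a1
    simp only [M, hχ0]
    rw [a1, ← a2]
  have hIoo : ∀ t ∈ Set.Ioo (-(1 / 4) : ℝ) (1 / 4), ∀ᶠ s in nhds t, χ s = s := by
    intro t ht
    filter_upwards [Ioo_mem_nhds ht.1 ht.2] with s hs using hχe s hs
  have hDt : ∀ t ∈ Set.Ioo (-(1 / 4) : ℝ) (1 / 4), ∀ x,
      SV.DD SV.et F (t, x) = deriv (fun s => Φ (s, x)) t := by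
    intro t ht x
    rw [← (SV.hasDerivAt_slice hF t x).deriv]
    apply Filter.EventuallyEq.deriv_eq
    filter_upwards [hIoo t ht] with s hs
    simp only [F, hs]
  have hw' : ∀ x, SV.DD SV.et F (0, x) = σ₁ x • SV.DD SV.b1 Φ₀ x + σ₂ x • SV.DD SV.b2 Φ₀ x
      + v x • n x := by
    intro x
    rw [hDt 0 (by norm_num)]
    exact hw x
  have hPP : P = SV.Par v₁ v₂ := hP
  subst hPP
  have hnear : ∀ᶠ t in nhds (0 : ℝ), t ∈ Set.Ioo (-(1 / 4) : ℝ) (1 / 4) :=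
    Ioo_mem_nhds (by norm_num) (by norm_num)
  have hGt : ∀ t ∈ Set.Ioo (-(1 / 4) : ℝ) (1 / 4), ∀ x,
      SV.GG (1, 0) (0, 1) (fun y => Φ (t, y)) x = SV.GG SV.s1 SV.s2 F (t, x) := by
    intro t ht x
    rw [← SV.GG_slice t x hF]
    simp only [F, hχe t ht]
  have hFt : ∀ t ∈ Set.Ioo (-(1 / 4) : ℝ) (1 / 4), ∀ x,
      Real.sqrt ((gmat (fun y => Φ (t, y)) x).det) = SV.FF SV.s1 SV.s2 F (t, x) := by
    intro t ht x
    rw [SV.gmat_det, hGt t ht]; rfl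
  have hcon : ∀ᶠ t in nhds (0 : ℝ), ∫ x in SV.Par v₁ v₂, SV.KK Q₁ Q₂ SV.s1 SV.s2 F M (t, x)
      * ⟪M (t, x), SV.DD SV.et F (t, x)⟫ * SV.FF SV.s1 SV.s2 F (t, x) = 0 := by
    filter_upwards [hnear] with t ht
    rw [← hconstraint t ⟨by linarith [ht.1], by linarith [ht.2]⟩]
    congr 1
    funext x
    rw [hFt t ht, hDt t ht, SV.qPairing_eq _ _ _ _ _ (by rw [hGt t ht]; exact (hG _).ne'),
      ← SV.KK_slice t x hF]
    simp only [F, M, hχe t ht]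
  have key := SV.core hv12 hcg hσ₁ hσ₂ hv hh hSs Q₁ Q₂ hEh hq hqS hF hM hG hFF hMM hMF hM1 hM2
    hdet hp1 hp2 hF0 hM0 hw' hcon
  have hAA : (fun t => ∫ x in SV.Par v₁ v₂, Real.sqrt ((gmat (fun y => Φ (t, y)) x).det))
      =ᶠ[nhds 0] fun t => ∫ x in SV.Par v₁ v₂, SV.FF SV.s1 SV.s2 F (t, x) := by
    filter_upwards [hnear] with t ht
    congr 1
    funext x
    exact hFt t ht x
  rw [hAA.deriv.deriv_eq, key]
  simp only [z4]
  rfl
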